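/- Let a_n = n² for n ≥ 1, let c = 1 − (1 + log log 2)/(log 2), and let ε > 0. Then for Lebesgue-almost all α ∈ [0,1] there exists N₀(α) such that for all N ≥ N₀(α) one has δ_min^α(N) ≥ (log N)^{c−1} (log₂ N)^{1/2} / (N² (log₃ N)^{1+ε}). -/

import Mathlib

open MeasureTheory Filter

/-- Distance to the nearest integer. -/
noncomputable def nint (x : ℝ) : ℝ := |x - round x|

/-- `δ_min^α(N) = min { ‖(a_m - a_n) α‖ : 1 ≤ m, n ≤ N, m ≠ n }`. -/
noncomputable def deltaMin (a : ℕ → ℕ) (α : ℝ) (N : ℕ) : ℝ :=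
  sInf {x : ℝ | ∃ m n : ℕ, 1 ≤ m ∧ m ≤ N ∧ 1 ≤ n ∧ n ≤ N ∧ m ≠ n ∧
    x = nint (((a m : ℝ) - (a n : ℝ)) * α)}

/-- `C_N = #(A_N - A_N)` where `A_N = {a_1, …, a_N}`. -/
noncomputable def diffCard (a : ℕ → ℕ) (N : ℕ) : ℕ :=
  (((Finset.Icc 1 N) ×ˢ (Finset.Icc 1 N)).image
    (fun p : ℕ × ℕ => (a p.1 : ℤ) - (a p.2 : ℤ))).card

/-- `log x`, read as `max {1, log x}`. -/
noncomputable def L (x : ℝ) : ℝ := max 1 (Real.log x)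

/-- `log₂ x = log log x`, with the `max {1, ·}` convention. -/
noncomputable def LL (x : ℝ) : ℝ := L (L x)

/-- `log₃ x = log log log x`, with the `max {1, ·}` convention. -/
noncomputable def LLL (x : ℝ) : ℝ := L (LL x)

section
open Finset ArithmeticFunction

lemma exists_abs_sum_vonMangoldt_div_sub_log_le : ∃ C ≥ 0, ∀ n : ℕ, 1 ≤ n →
    |∑ q ∈ Ioc 0 n, vonMangoldt q / q - Real.log n| ≤ C := by
  refine ⟨Real.log 4 + 4, by positivity, fun n hn => ?_⟩
  have hn' : (0 : ℝ) < n := by exact_mod_cast hn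
  have h1 : ∑ q ∈ Ioc 0 n, vonMangoldt q * ((n / q : ℕ) : ℝ) = Real.log n.factorial := by
    rw [← sum_Ioc_mul_zeta_eq_sum, vonMangoldt_mul_zeta]
    simp only [log_apply]
    rw [← Finset.prod_Ico_id_eq_factorial, Nat.cast_prod, Real.log_prod]
    · rfl
    · intro i hi
      have := (Finset.mem_Ico.mp hi).1
      positivity
  have h2 : Real.log n.factorial ≤ n * Real.log n := by
    rw [← Real.log_pow]
    exact Real.log_le_log (by positivity) (by exact_mod_cast Nat.factorial_le_pow n)
  have h3 := Stirling.le_log_factorial_stirling (n := n) (by omega)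
  have h3a : 0 ≤ Real.log n := Real.log_natCast_nonneg n
  have h3b : 0 ≤ Real.log (2 * Real.pi) := Real.log_nonneg (by linarith [Real.pi_gt_three])
  have hpsi : ∑ q ∈ Ioc 0 n, vonMangoldt q ≤ (Real.log 4 + 4) * n := by
    have := Chebyshev.psi_le_const_mul_self hn'.le
    rwa [Chebyshev.psi, Nat.floor_natCast] at this
  have h4 : Real.log n.factorial ≤ n * ∑ q ∈ Ioc 0 n, vonMangoldt q / q := by
    rw [← h1, Finset.mul_sum]
    refine Finset.sum_le_sum fun q hq => ?_
    have : ((n / q : ℕ) : ℝ) ≤ n / q := Nat.cast_div_le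
    calc _ ≤ vonMangoldt q * ((n : ℝ) / q) := mul_le_mul_of_nonneg_left this vonMangoldt_nonneg
      _ = _ := by ring
  have h5 : n * ∑ q ∈ Ioc 0 n, vonMangoldt q / q ≤ Real.log n.factorial +
      ∑ q ∈ Ioc 0 n, vonMangoldt q := by
    rw [← h1, Finset.mul_sum, ← Finset.sum_add_distrib]
    refine Finset.sum_le_sum fun q hq => ?_
    have : (n : ℝ) / q ≤ ((n / q : ℕ) : ℝ) + 1 := by
      rw [← Nat.floor_div_eq_div (K := ℝ)]
      exact (Nat.lt_floor_add_one _).le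
    calc n * (vonMangoldt q / q) = vonMangoldt q * ((n : ℝ) / q) := by ring
      _ ≤ vonMangoldt q * (((n / q : ℕ) : ℝ) + 1) :=
        mul_le_mul_of_nonneg_left this vonMangoldt_nonneg
      _ = _ := by ring
  have hlog4 : 0 ≤ Real.log 4 := Real.log_nonneg (by norm_num)
  rw [abs_le]
  constructor
  · have : n * (Real.log n - 1) ≤ n * ∑ q ∈ Ioc 0 n, vonMangoldt q / q := by linarith
    have := le_of_mul_le_mul_left this hn'
    linarith
  · have : n * ∑ q ∈ Ioc 0 n, vonMangoldt q / q ≤ n * (Real.log n + (Real.log 4 + 4)) := by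
      linarith
    have := le_of_mul_le_mul_left this hn'
    linarith

lemma exists_sum_vonMangoldt_div_not_prime_le : ∃ C ≥ 0, ∀ n : ℕ,
    ∑ q ∈ Ioc 0 n with ¬ q.Prime, vonMangoldt q / q ≤ C := by
  obtain ⟨C, hC⟩ := Chebyshev.psi_sub_theta_le_mul_sqrt
  have hB : ∀ n : ℕ, ∑ q ∈ Ioc 0 n with ¬ q.Prime, vonMangoldt q ≤ C * √n := by
    intro n
    have h := hC n
    rwa [Chebyshev.psi_sub_theta_eq_sum_not_prime, Nat.floor_natCast] at h
  have hC0 : 0 ≤ C := by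
    have := (Finset.sum_nonneg fun q _ => vonMangoldt_nonneg).trans (hB 1)
    simpa using this
  have hX : ∀ n : ℕ, ∑ q ∈ Ioc 0 (n + 1) with ¬ q.Prime, vonMangoldt q / q ≤
      (∑ q ∈ Ioc 0 (n + 1) with ¬ q.Prime, vonMangoldt q) / (n + 1) +
        2 * C * (1 - 1 / √((n : ℝ) + 1)) := by
    intro n
    induction n with
    | zero =>
      rw [show Ioc 0 (0 + 1) = {1} from rfl, Finset.filter_singleton, if_pos Nat.not_prime_one]
      simp
    | succ n ih =>
      set b : ℕ → ℝ := fun q => if q.Prime then 0 else vonMangoldt q with hb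
      have e : ∀ m : ℕ, ∑ q ∈ Ioc 0 m with ¬ q.Prime, vonMangoldt q = ∑ q ∈ Ioc 0 m, b q := by
        intro m
        rw [Finset.sum_filter]
        exact Finset.sum_congr rfl fun q _ => by simp [hb]
      have e' : ∀ m : ℕ, ∑ q ∈ Ioc 0 m with ¬ q.Prime, vonMangoldt q / q =
          ∑ q ∈ Ioc 0 m, b q / q := by
        intro m
        rw [Finset.sum_filter]
        exact Finset.sum_congr rfl fun q _ => by simp only [hb]; split_ifs <;> simp_all
      have hBn := hB (n + 1)
      rw [e] at hBn
      rw [e, e'] at ih ⊢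
      rw [Finset.sum_Ioc_succ_top (by omega : 0 ≤ n + 1),
        Finset.sum_Ioc_succ_top (by omega : 0 ≤ n + 1)]
      set B := ∑ q ∈ Ioc 0 (n + 1), b q
      push_cast at hBn ⊢
      set x := √((n : ℝ) + 1) with hx
      set y := √((n : ℝ) + 1 + 1) with hy
      have hx0 : 0 < x := Real.sqrt_pos.mpr (by positivity)
      have hx2 : x ^ 2 = (n : ℝ) + 1 := Real.sq_sqrt (by positivity)
      have hy2 : y ^ 2 = (n : ℝ) + 1 + 1 := Real.sq_sqrt (by positivity)
      have hxy : x ≤ y := Real.sqrt_le_sqrt (by linarith)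
      rw [← hy2]
      rw [← hx2] at ih
      have h1 : B / x ^ 2 - B / y ^ 2 ≤ 2 * C * (1 / x - 1 / y) := by
        have hy0 : 0 < y := hx0.trans_le hxy
        have h2 : B / x ^ 2 - B / y ^ 2 = B / (x ^ 2 * y ^ 2) := by
          have : y ^ 2 = x ^ 2 + 1 := by rw [hy2, hx2]
          field_simp
          rw [this]; ring
        have h3 : 1 / x - 1 / y = 1 / (x * y * (x + y)) := by
          have : (y - x) * (x + y) = 1 := by nlinarith
          field_simp
          linarith
        rw [h2, h3]
        calc B / (x ^ 2 * y ^ 2) ≤ C * x / (x ^ 2 * y ^ 2) := by gcongr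
          _ = 2 * C * (1 / (x * y * (y + y))) := by field_simp; norm_num
          _ ≤ _ := by gcongr
      rw [add_div]
      linarith
  refine ⟨3 * C, by positivity, fun n => ?_⟩
  cases n with
  | zero => simpa using hC0
  | succ n =>
    refine (hX n).trans ?_
    have h1 := hB (n + 1)
    push_cast at h1
    have hs : 1 ≤ √((n : ℝ) + 1) := by rw [Real.one_le_sqrt]; linarith [n.cast_nonneg (α := ℝ)]
    have h2 : (∑ q ∈ Ioc 0 (n + 1) with ¬ q.Prime, vonMangoldt q) / ((n : ℝ) + 1) ≤ C := by
      rw [div_le_iff₀ (by positivity)]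
      refine h1.trans (mul_le_mul_of_nonneg_left ?_ hC0)
      nth_rewrite 2 [← Real.mul_self_sqrt (show (0 : ℝ) ≤ n + 1 by positivity)]
      nlinarith
    have h3 : 0 ≤ 2 * C * (1 / √((n : ℝ) + 1)) := by positivity
    linarith

lemma exists_abs_sum_log_div_sub_log_le : ∃ C ≥ 0, ∀ n : ℕ, 1 ≤ n →
    |∑ p ∈ Ioc 0 n with p.Prime, Real.log p / p - Real.log n| ≤ C := by
  obtain ⟨C, hC, h⟩ := exists_abs_sum_vonMangoldt_div_sub_log_le
  obtain ⟨D, hD, h'⟩ := exists_sum_vonMangoldt_div_not_prime_le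
  refine ⟨C + D, by positivity, fun n hn => ?_⟩
  have h1 := h n hn
  have h2 : 0 ≤ ∑ q ∈ Ioc 0 n with ¬ q.Prime, vonMangoldt q / (q : ℝ) :=
    Finset.sum_nonneg fun q _ => div_nonneg vonMangoldt_nonneg (Nat.cast_nonneg q)
  have h3 := h' n
  rw [← Finset.sum_filter_add_sum_filter_not _ Nat.Prime] at h1
  rw [Finset.sum_congr rfl fun p hp => by
    rw [vonMangoldt_apply_prime (Finset.mem_filter.mp hp).2]] at h1
  rw [abs_le] at h1 ⊢
  constructor <;> linarith

lemma exists_abs_sum_prime_inv_sub_log_log_le : ∃ C ≥ 0, ∀ n : ℕ, 2 ≤ n →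
    |∑ p ∈ Ioc 0 n with p.Prime, 1 / (p : ℝ) - Real.log (Real.log n)| ≤ C := by
  obtain ⟨C, hC, h⟩ := exists_abs_sum_log_div_sub_log_le
  set s : ℕ → ℝ := fun n => ∑ p ∈ Ioc 0 n with p.Prime, 1 / (p : ℝ) with hs
  set E : ℕ → ℝ := fun n => ∑ p ∈ Ioc 0 n with p.Prime, Real.log p / p - Real.log n with hE
  set X : ℕ → ℝ := fun n => s n - Real.log (Real.log n) - E n / Real.log n with hX
  have hE' : ∀ n : ℕ, 1 ≤ n → |E n| ≤ C := h
  have hstep : ∀ n : ℕ, 2 ≤ n → |X (n + 1) - X n| ≤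
      (1 + C) * (1 / Real.log n - 1 / Real.log (n + 1)) := by
    intro n hn
    set t : ℝ := if (n + 1).Prime then 1 else 0 with ht
    have hs1 : s (n + 1) = s n + t / (n + 1) := by
      simp only [hs, Finset.sum_filter]
      rw [Finset.sum_Ioc_succ_top (by omega), ht]
      split_ifs <;> simp
    have hE1 : E (n + 1) = E n + t * Real.log (n + 1) / (n + 1) - Real.log (n + 1)
        + Real.log n := by
      simp only [hE, Finset.sum_filter]
      rw [Finset.sum_Ioc_succ_top (by omega), ht]
      split_ifs <;> push_cast <;> ring
    have hn' : (2 : ℝ) ≤ n := by exact_mod_cast hn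
    set a := Real.log n with ha
    set b := Real.log (n + 1) with hb
    have ha0 : 0 < a := Real.log_pos (by linarith)
    have hab : a ≤ b := Real.log_le_log (by linarith) (by linarith)
    have hb0 : 0 < b := ha0.trans_le hab
    have hba : b - a ≤ 1 := by
      rw [hb, ha, ← Real.log_div (by positivity) (by positivity)]
      have := Real.log_le_sub_one_of_pos (show 0 < ((n : ℝ) + 1) / n by positivity)
      have h2 : ((n : ℝ) + 1) / n - 1 ≤ 1 := by
        rw [sub_le_iff_le_add, div_le_iff₀ (by positivity)]; linarith
      linarith
    have hl1 : Real.log b - Real.log a ≤ b / a - 1 := by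
      rw [← Real.log_div hb0.ne' ha0.ne']
      exact Real.log_le_sub_one_of_pos (by positivity)
    have hl2 : 1 - a / b ≤ Real.log b - Real.log a := by
      have := Real.log_le_sub_one_of_pos (show 0 < a / b by positivity)
      rw [Real.log_div ha0.ne' hb0.ne'] at this
      linarith
    have hd : X (n + 1) - X n = -(Real.log b - Real.log a) + (1 - a / b)
        + E n * (1 / a - 1 / b) := by
      simp only [hX]
      rw [hs1, hE1]
      push_cast
      rw [← ha, ← hb]
      field_simp
      ring
    have hEn := abs_le.mp (hE' n (by omega))
    have hδ : 0 ≤ 1 / a - 1 / b := sub_nonneg.mpr (one_div_le_one_div_of_le ha0 hab)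
    have hq : (b / a - 1) - (1 - a / b) ≤ 1 / a - 1 / b := by
      have e1 : (b / a - 1) - (1 - a / b) = (b - a) * (1 / a - 1 / b) := by field_simp
      rw [e1]
      nlinarith
    rw [hd, abs_le]
    constructor <;> nlinarith
  have hsum : ∀ n : ℕ, |X (n + 2) - X 2| ≤
      (1 + C) * (1 / Real.log 2 - 1 / Real.log ((n : ℝ) + 2)) := by
    intro n
    induction n with
    | zero => simp
    | succ n ih =>
      have h1 := hstep (n + 2) (by omega)
      have h2 := abs_sub_le (X (n + 1 + 2)) (X (n + 2)) (X 2)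
      rw [show n + 2 + 1 = n + 1 + 2 by ring] at h1
      push_cast at h1 ⊢
      rw [show (n : ℝ) + 1 + 2 = n + 2 + 1 by ring]
      linarith
  have hlog2 := Real.log_pos one_lt_two
  refine ⟨(1 + C) / Real.log 2 + |X 2| + C / Real.log 2, by positivity, fun n hn => ?_⟩
  obtain ⟨m, rfl⟩ := Nat.exists_eq_add_of_le' hn
  have h1 := hsum m
  have hlm : Real.log 2 ≤ Real.log ((m + 2 : ℕ) : ℝ) :=
    Real.log_le_log two_pos (by push_cast; linarith [m.cast_nonneg (α := ℝ)])
  have hlm0 := hlog2.trans_le hlm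
  have h2 : (1 + C) * (1 / Real.log 2 - 1 / Real.log ((m : ℝ) + 2)) ≤ (1 + C) / Real.log 2 := by
    have : 0 ≤ (1 + C) * (1 / Real.log ((m : ℝ) + 2)) := by
      push_cast at hlm0; positivity
    rw [mul_sub, mul_one_div]
    linarith
  have h3 : |E (m + 2) / Real.log ((m + 2 : ℕ) : ℝ)| ≤ C / Real.log 2 := by
    rw [abs_div, abs_of_pos hlm0]
    exact div_le_div₀ hC (hE' _ (by omega)) hlog2 hlm
  have h4 : s (m + 2) - Real.log (Real.log ((m + 2 : ℕ) : ℝ)) =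
      (X (m + 2) - X 2) + X 2 + E (m + 2) / Real.log ((m + 2 : ℕ) : ℝ) := by
    simp only [hX]; ring
  change |s (m + 2) - Real.log (Real.log ((m + 2 : ℕ) : ℝ))| ≤ _
  rw [h4]
  refine (abs_add_le _ _).trans (add_le_add ((abs_add_le _ _).trans ?_) h3)
  linarith

lemma sum_log_div_filter_floor_le (n : ℕ) (k : ℤ) :
    ∑ p ∈ Ioc 0 n with Nat.Prime p ∧ ⌊Real.log (p : ℝ)⌋ = k, Real.log p / (p : ℝ) ≤
      Real.log 4 * Real.exp 1 := by
  calc _ ≤ ∑ p ∈ Ioc 0 ⌊Real.exp (k + 1)⌋₊ with p.Prime, Real.log p * Real.exp (-k) := by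
        refine (Finset.sum_le_sum fun p hp => ?_).trans
          (Finset.sum_le_sum_of_subset_of_nonneg ?_ fun p _ _ =>
            mul_nonneg (Real.log_natCast_nonneg p) (Real.exp_pos _).le)
        · rw [Finset.mem_filter] at hp
          have hp0 : (0 : ℝ) < p := by exact_mod_cast hp.2.1.pos
          rw [div_eq_mul_inv, Real.exp_neg]
          refine mul_le_mul_of_nonneg_left (inv_anti₀ (Real.exp_pos _) ?_)
            (Real.log_natCast_nonneg p)
          rw [← Real.le_log_iff_exp_le hp0, ← hp.2.2]
          exact Int.floor_le _
        · intro p hp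
          rw [Finset.mem_filter, Finset.mem_Ioc] at hp ⊢
          have hp0 : (0 : ℝ) < p := by exact_mod_cast hp.2.1.pos
          refine ⟨⟨hp.1.1, Nat.le_floor ?_⟩, hp.2.1⟩
          rw [← Real.log_le_iff_le_exp hp0, ← hp.2.2]
          exact (Int.lt_floor_add_one _).le
    _ = Chebyshev.theta (Real.exp (k + 1)) * Real.exp (-k) := by
        rw [Chebyshev.theta, Finset.sum_mul]
    _ ≤ Real.log 4 * Real.exp (k + 1) * Real.exp (-k) := by
        gcongr
        exact Chebyshev.theta_le_log4_mul_x (Real.exp_pos _).le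
    _ = _ := by rw [mul_assoc, ← Real.exp_add]; congr 2; ring

lemma exists_sum_log_div_mul_exp_le : ∃ C ≥ 0, ∀ (n : ℕ) (z A : ℝ), 0 ≤ A →
    ∑ p ∈ Ioc 0 n with p.Prime,
      Real.log p / p * Real.exp (-max 0 (|Real.log p - z| - A)) ≤ C * (1 + A) := by
  have hg : Summable fun j : ℕ => Real.exp (-j) := Real.summable_exp_neg_nat
  have hG0 : 0 ≤ ∑' j : ℕ, Real.exp (-j) := tsum_nonneg fun j => (Real.exp_pos _).le
  set G := ∑' j : ℕ, Real.exp (-j) with hGdef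
  have hlog4 : 0 ≤ Real.log 4 := Real.log_nonneg (by norm_num)
  refine ⟨2 * (Real.log 4 * Real.exp 1) * (3 + G), by positivity, fun n z A hA => ?_⟩
  set M := ⌈A⌉₊ + 1 with hM
  set f : ℕ → ℕ := fun p => (⌊Real.log p⌋ - ⌊z⌋).natAbs with hf
  obtain ⟨N, hN⟩ : ∃ N, ∀ p ∈ (Ioc 0 n).filter Nat.Prime, f p ∈ range N := by
    refine ⟨((Ioc 0 n).filter Nat.Prime).sup f + 1, fun p hp => ?_⟩
    rw [Finset.mem_range]
    have := Finset.le_sup (f := f) hp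
    omega
  have hM' : (M : ℝ) ≤ A + 2 := by
    have := Nat.ceil_lt_add_one hA
    rw [hM]; push_cast; linarith
  have hMA : A + 1 ≤ (M : ℝ) := by
    have := Nat.le_ceil A
    rw [hM]; push_cast; linarith
  rw [← Finset.sum_fiberwise_of_maps_to hN]
  calc _ ≤ ∑ j ∈ range N, 2 * (Real.log 4 * Real.exp 1) * Real.exp (-((j - M : ℕ) : ℝ)) := by
        refine Finset.sum_le_sum fun j _ => ?_
        calc _ ≤ ∑ p ∈ (Ioc 0 n).filter Nat.Prime with f p = j,
              Real.log p / p * Real.exp (-((j - M : ℕ) : ℝ)) := by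
              refine Finset.sum_le_sum fun p hp => ?_
              rw [Finset.mem_filter] at hp
              have hnn : 0 ≤ Real.log p / p :=
                div_nonneg (Real.log_natCast_nonneg p) (Nat.cast_nonneg p)
              refine mul_le_mul_of_nonneg_left (Real.exp_le_exp.mpr (neg_le_neg ?_)) hnn
              rcases le_total j M with h | h
              · rw [Nat.sub_eq_zero_of_le h, Nat.cast_zero]
                exact le_max_left _ _
              · rw [Nat.cast_sub h]
                refine le_trans ?_ (le_max_right _ _)
                have e1 : (j : ℝ) = |(⌊Real.log p⌋ : ℝ) - ⌊z⌋| := by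
                  rw [← hp.2, hf, Nat.cast_natAbs]
                  push_cast
                  rfl
                have e2 : |(⌊Real.log p⌋ : ℝ) - ⌊z⌋| ≤ |Real.log p - z| + 1 := by
                  have a1 := Int.floor_le (Real.log p)
                  have a2 := Int.lt_floor_add_one (Real.log p)
                  have a3 := Int.floor_le z
                  have a4 := Int.lt_floor_add_one z
                  rw [abs_le]
                  have := abs_le.mp (le_refl |Real.log p - z|)
                  constructor <;> linarith
                linarith
          _ = (∑ p ∈ (Ioc 0 n).filter Nat.Prime with f p = j, Real.log p / p) *
                Real.exp (-((j - M : ℕ) : ℝ)) := by rw [Finset.sum_mul]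
          _ ≤ _ := by
              refine mul_le_mul_of_nonneg_right ?_ (Real.exp_pos _).le
              have b1 := sum_log_div_filter_floor_le n (⌊z⌋ + j)
              have b2 := sum_log_div_filter_floor_le n (⌊z⌋ - j)
              refine le_trans ?_ ((add_le_add b1 b2).trans (le_of_eq (two_mul _).symm))
              have hnn : ∀ p : ℕ, 0 ≤ Real.log p / p := fun p =>
                div_nonneg (Real.log_natCast_nonneg p) (Nat.cast_nonneg p)
              rw [← Finset.sum_union_inter]
              refine le_trans ?_ (le_add_of_nonneg_right (Finset.sum_nonneg fun p _ => hnn p))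
              refine Finset.sum_le_sum_of_subset_of_nonneg ?_ fun p _ _ => hnn p
              intro p hp
              rw [Finset.mem_filter, Finset.mem_filter] at hp
              rw [Finset.mem_union, Finset.mem_filter, Finset.mem_filter]
              have : (⌊Real.log p⌋ - ⌊z⌋).natAbs = j := hp.2
              rcases le_total (⌊Real.log p⌋) ⌊z⌋ with h | h
              · exact Or.inr ⟨hp.1.1, hp.1.2, by omega⟩
              · exact Or.inl ⟨hp.1.1, hp.1.2, by omega⟩
    _ = 2 * (Real.log 4 * Real.exp 1) * ∑ j ∈ range N, Real.exp (-((j - M : ℕ) : ℝ)) := by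
        rw [Finset.mul_sum]
    _ ≤ 2 * (Real.log 4 * Real.exp 1) * (M + G) := by
        refine mul_le_mul_of_nonneg_left ?_ (by positivity)
        calc _ ≤ ∑ j ∈ range (M + N), Real.exp (-((j - M : ℕ) : ℝ)) :=
              Finset.sum_le_sum_of_subset_of_nonneg
                (Finset.range_subset_range.mpr (by omega)) fun j _ _ => (Real.exp_pos _).le
          _ = ∑ j ∈ range M, Real.exp (-((j - M : ℕ) : ℝ)) +
                ∑ j ∈ range N, Real.exp (-(j : ℝ)) := by
              rw [Finset.sum_range_add]
              simp
          _ ≤ _ := by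
              refine add_le_add ?_ (hg.sum_le_tsum _ fun j _ => (Real.exp_pos _).le)
              refine (Finset.sum_le_sum fun j _ => Real.exp_le_one_iff.mpr
                (neg_nonpos.mpr (Nat.cast_nonneg _))).trans ?_
              simp
    _ ≤ 2 * (Real.log 4 * Real.exp 1) * ((3 + G) * (1 + A)) := by
        refine mul_le_mul_of_nonneg_left ?_ (by positivity)
        nlinarith
    _ = _ := by ring

end

section
open Finset

/-- The `t`-th coefficient of `(1 - X) exp (m X)`. -/
noncomputable def abelCoeff (m t : ℕ) : ℝ :=
  (m : ℝ) ^ t / (t.factorial : ℝ) - (t : ℝ) * (m : ℝ) ^ (t - 1) / (t.factorial : ℝ)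

lemma abelCoeff_zero (m : ℕ) : abelCoeff m 0 = 1 := by simp [abelCoeff]

lemma abelCoeff_succ (m t : ℕ) :
    abelCoeff m (t + 1) = (m : ℝ) ^ (t + 1) / ((t + 1).factorial : ℝ) -
      (m : ℝ) ^ t / (t.factorial : ℝ) := by
  have : (t.factorial : ℝ) ≠ 0 := by positivity
  have h : ((t : ℝ) + 1) ≠ 0 := by positivity
  rw [abelCoeff, Nat.factorial_succ]
  push_cast
  field_simp

lemma sum_antidiagonal_pow_div_factorial (m t : ℕ) :
    ∑ x ∈ antidiagonal t, (m : ℝ) ^ x.1 / (x.1.factorial : ℝ) * (1 / (x.2.factorial : ℝ)) =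
      ((m + 1 : ℕ) : ℝ) ^ t / (t.factorial : ℝ) := by
  have key := (Commute.all (m : ℝ) 1).add_pow' t
  push_cast
  rw [key, Finset.sum_div]
  refine Finset.sum_congr rfl fun x hx => ?_
  rw [HasAntidiagonal.mem_antidiagonal] at hx
  subst hx
  have h := Nat.add_choose_mul_factorial_mul_factorial x.1 x.2
  rw [← Nat.choose_symm_add] at h
  have h' : ((x.1 + x.2).choose x.1 : ℝ) * x.1.factorial * x.2.factorial =
    (x.1 + x.2).factorial := by exact_mod_cast h
  have h1 : (x.1.factorial : ℝ) ≠ 0 := by positivity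
  have h2 : (x.2.factorial : ℝ) ≠ 0 := by positivity
  have h3 : ((x.1 + x.2).factorial : ℝ) ≠ 0 := by positivity
  simp only [one_pow, mul_one, nsmul_eq_mul]
  field_simp
  rw [← h']
  ring

lemma sum_antidiagonal_abelCoeff (m t : ℕ) :
    ∑ x ∈ antidiagonal t, abelCoeff m x.1 / (x.2.factorial : ℝ) = abelCoeff (m + 1) t := by
  cases t with
  | zero => simp [abelCoeff_zero]
  | succ t =>
    rw [Finset.Nat.sum_antidiagonal_succ, abelCoeff_succ (m + 1) t,
      ← sum_antidiagonal_pow_div_factorial, ← sum_antidiagonal_pow_div_factorial,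
      Finset.Nat.sum_antidiagonal_succ]
    simp only [abelCoeff_zero, abelCoeff_succ]
    rw [add_sub_assoc, ← Finset.sum_sub_distrib]
    congr 1
    · simp
    · refine Finset.sum_congr rfl fun x _ => ?_
      ring

lemma abelCoeff_eq {m : ℕ} (hm : 0 < m) (t : ℕ) :
    abelCoeff m t = (m : ℝ) ^ t / (t.factorial : ℝ) * (((m : ℝ) - t) / m) := by
  have hm' : (m : ℝ) ≠ 0 := by positivity
  cases t with
  | zero => simp [abelCoeff_zero, hm']
  | succ t =>
    rw [abelCoeff_succ, Nat.factorial_succ]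
    have : (t.factorial : ℝ) ≠ 0 := by positivity
    have h : ((t : ℝ) + 1) ≠ 0 := by positivity
    push_cast
    field_simp
    ring

lemma abelCoeff_nonneg {m : ℕ} (hm : 0 < m) {t : ℕ} (h : t ≤ m) : 0 ≤ abelCoeff m t := by
  rw [abelCoeff_eq hm]
  have : (t : ℝ) ≤ m := by exact_mod_cast h
  have : 0 ≤ (m : ℝ) - t := by linarith
  positivity

lemma abelCoeff_self {m : ℕ} (hm : 0 < m) : abelCoeff m m = 0 := by
  rw [abelCoeff_eq hm]; simp

open Classical in
/-- Total weight `∏ 1 / sᵢ!` of the tuples `(s₁, …, sₙ)` with sum `k`, all of whose nonempty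
initial sums are admissible in the sense of `ok`. -/
noncomputable def pathWeight (ok : ℕ → ℕ → Prop) : ℕ → ℕ → ℝ
  | 0, k => if k = 0 then 1 else 0
  | n + 1, k => if ok (n + 1) k then
      ∑ x ∈ antidiagonal k, pathWeight ok n x.1 / (x.2.factorial : ℝ) else 0

lemma pathWeight_nonneg (ok : ℕ → ℕ → Prop) (n k : ℕ) : 0 ≤ pathWeight ok n k := by
  induction n generalizing k with
  | zero => rw [pathWeight]; split_ifs <;> norm_num
  | succ n ih =>
    rw [pathWeight]
    split_ifs
    · exact Finset.sum_nonneg fun x _ => div_nonneg (ih _) (by positivity)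
    · exact le_rfl

lemma pathWeight_eq_zero {ok : ℕ → ℕ → Prop} (h0 : ok 0 0) {n k : ℕ} (h : ¬ ok n k) :
    pathWeight ok n k = 0 := by
  cases n with
  | zero =>
    rw [pathWeight, if_neg]
    rintro rfl
    exact h h0
  | succ n => rw [pathWeight, if_neg h]

lemma pathWeight_le_abelCoeff {n k : ℕ} (hk : k ≤ n) :
    pathWeight (fun n k => k ≤ n) n k ≤ abelCoeff (n + 1) k := by
  induction n generalizing k with
  | zero =>
    obtain rfl : k = 0 := by omega
    simp [pathWeight, abelCoeff_zero]
  | succ n ih =>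
    rw [pathWeight, if_pos hk, ← sum_antidiagonal_abelCoeff]
    refine Finset.sum_le_sum fun x hx => ?_
    rw [HasAntidiagonal.mem_antidiagonal] at hx
    refine div_le_div_of_nonneg_right ?_ (by positivity)
    by_cases hx1 : x.1 ≤ n
    · exact ih hx1
    · rw [pathWeight_eq_zero (ok := fun n k => k ≤ n) le_rfl hx1]
      exact abelCoeff_nonneg (by omega) (by omega)

lemma sum_pathWeight_mul_abelCoeff_le (n m : ℕ) :
    ∑ x ∈ antidiagonal (n + m), pathWeight (fun n k => n ≤ k + 1) n x.1 * abelCoeff (m + 2) x.2 ≤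
      abelCoeff (n + m + 2) (n + m) := by
  induction n generalizing m with
  | zero =>
    rw [Finset.sum_eq_single (0, m)]
    · simp [pathWeight]
    · intro x hx hne
      rw [HasAntidiagonal.mem_antidiagonal] at hx
      rw [pathWeight, if_neg, zero_mul]
      intro h
      apply hne
      ext <;> simp <;> omega
    · intro h; exact absurd (by simp) h
  | succ n ih =>
    have h := ih (m + 1)
    rw [show n + (m + 1) + 2 = n + 1 + m + 2 by ring, show n + (m + 1) = n + 1 + m by ring] at h
    refine le_trans (le_of_eq ?_) h
    calc ∑ x ∈ antidiagonal (n + 1 + m),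
          pathWeight (fun n k => n ≤ k + 1) (n + 1) x.1 * abelCoeff (m + 2) x.2
        = ∑ x ∈ antidiagonal (n + 1 + m), ∑ y ∈ antidiagonal x.1,
          pathWeight (fun n k => n ≤ k + 1) n y.1 / (y.2.factorial : ℝ) *
            abelCoeff (m + 2) x.2 := by
          refine Finset.sum_congr rfl fun x hx => ?_
          rw [HasAntidiagonal.mem_antidiagonal] at hx
          rw [pathWeight]
          split_ifs with hx1
          · rw [Finset.sum_mul]
          · rw [zero_mul, eq_comm]
            refine Finset.sum_eq_zero fun y hy => ?_
            rw [HasAntidiagonal.mem_antidiagonal] at hy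
            by_cases hy1 : n ≤ y.1 + 1
            · obtain h2 : x.2 = m + 2 := by omega
              rw [h2, abelCoeff_self (by omega), mul_zero]
            · rw [pathWeight_eq_zero (ok := fun n k => n ≤ k + 1) (by simp) hy1]; simp
      _ = ∑ x ∈ antidiagonal (n + 1 + m), ∑ y ∈ antidiagonal x.2,
          pathWeight (fun n k => n ≤ k + 1) n x.1 / (y.1.factorial : ℝ) *
            abelCoeff (m + 2) y.2 := by
          rw [Finset.sum_sigma', Finset.sum_sigma']
          refine Finset.sum_nbij' (fun ⟨⟨_, j⟩, ⟨k, l⟩⟩ => ⟨(k, l + j), (l, j)⟩)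
            (fun ⟨⟨i, _⟩, ⟨k, l⟩⟩ => ⟨(i + k, l), (i, k)⟩) ?_ ?_ ?_ ?_ ?_ <;>
          (rintro ⟨⟨a, b⟩, ⟨c, d⟩⟩; simp; try omega)
      _ = _ := by
          refine Finset.sum_congr rfl fun x _ => ?_
          rw [show m + 1 + 2 = (m + 2) + 1 by ring, ← sum_antidiagonal_abelCoeff, Finset.mul_sum,
            ← Finset.Nat.sum_antidiagonal_swap]
          refine Finset.sum_congr rfl fun y _ => ?_
          simp only [Prod.fst_swap, Prod.snd_swap]
          ring

/-- The profile `(n + 1) ^ (-3/2)`. -/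
noncomputable def ballotDecay (n : ℕ) : ℝ := 1 / (((n : ℝ) + 1) * √((n : ℝ) + 1))

lemma ballotDecay_pos (n : ℕ) : 0 < ballotDecay n := by unfold ballotDecay; positivity

lemma ballotDecay_antitone : Antitone ballotDecay := by
  intro a b h
  have : (a : ℝ) ≤ b := by exact_mod_cast h
  unfold ballotDecay
  gcongr

lemma sqrt_mul_self_pow_le (n : ℕ) :
    √(n : ℝ) * (n : ℝ) ^ n ≤ (n.factorial : ℝ) * Real.exp 1 ^ n := by
  have h := Stirling.le_factorial_stirling n
  have h2 : √(n : ℝ) ≤ √(2 * Real.pi * n) := by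
    apply Real.sqrt_le_sqrt
    nlinarith [Real.pi_gt_three, (Nat.cast_nonneg n : (0 : ℝ) ≤ n)]
  have h3 : √(n : ℝ) * ((n : ℝ) / Real.exp 1) ^ n ≤ n.factorial :=
    le_trans (by gcongr) h
  rw [div_pow, ← mul_div_assoc, div_le_iff₀ (by positivity)] at h3
  exact h3

lemma factorial_succ_le (n : ℕ) :
    ((n + 1).factorial : ℝ) ≤
      Real.exp 1 * √((n : ℝ) + 1) * (((n : ℝ) + 1) / Real.exp 1) ^ (n + 1) := by
  have h := Stirling.stirlingSeq'_antitone (Nat.zero_le n)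
  simp only [Function.comp, Nat.succ_eq_add_one, zero_add, Stirling.stirlingSeq_one] at h
  unfold Stirling.stirlingSeq at h
  rw [div_le_iff₀ (by positivity), Real.sqrt_mul (by norm_num)] at h
  refine h.trans (le_of_eq ?_)
  push_cast
  have : √(2 : ℝ) ≠ 0 := by positivity
  field_simp

lemma pow_div_factorial_le_of_le {n k : ℕ} (hk : k ≤ n) :
    ((n : ℝ) + 1) ^ k / (k.factorial : ℝ) ≤ ((n : ℝ) + 1) ^ n / (n.factorial : ℝ) := by
  obtain ⟨j, rfl⟩ := Nat.exists_eq_add_of_le hk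
  have h := Nat.factorial_mul_descFactorial (n := k + j) (k := j) (by omega)
  rw [Nat.add_sub_cancel] at h
  have h1 : ((k + j).descFactorial j : ℝ) ≤ (((k + j : ℕ) : ℝ) + 1) ^ j := by
    calc ((k + j).descFactorial j : ℝ) ≤ ((k + j : ℕ) : ℝ) ^ j := by
          exact_mod_cast Nat.descFactorial_le_pow _ _
      _ ≤ _ := by gcongr; linarith
  rw [← h, pow_add, div_le_div_iff₀ (by positivity) (by
    have := (Nat.factorial_pos (k+j)); rw [← h] at this; exact_mod_cast this)]
  push_cast at h1 ⊢
  calc ((k : ℝ) + j + 1) ^ k * (k.factorial * ((k + j).descFactorial j : ℝ))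
      ≤ ((k : ℝ) + j + 1) ^ k * (k.factorial * ((k : ℝ) + j + 1) ^ j) := by gcongr
    _ = _ := by ring

lemma one_lt_two_mul_log_two : 1 < 2 * Real.log 2 := by linarith [Real.log_two_gt_d9]

lemma exists_sum_pathWeight_le_le :
    ∃ C > 0, ∀ n : ℕ,
      ∑ k ∈ range (n + 1), (2 * Real.log 2) ^ k * pathWeight (fun n k => k ≤ n) n k ≤
        C * (2 * Real.log 2 * Real.exp 1) ^ n * ballotDecay n := by
  set μ := 2 * Real.log 2 with hμ
  have hμ1 : 1 < μ := one_lt_two_mul_log_two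
  have hμ0 : 0 < μ := by linarith
  have hr : ‖μ⁻¹‖ < 1 := by
    rw [Real.norm_of_nonneg (by positivity)]; exact inv_lt_one_of_one_lt₀ hμ1
  have hs : Summable fun h : ℕ => ((h : ℝ) + 1) * μ⁻¹ ^ h := by
    have h1 := summable_pow_mul_geometric_of_norm_lt_one 1 hr
    have h0 := summable_geometric_of_norm_lt_one hr
    simpa [add_mul] using h1.add h0
  refine ⟨Real.exp 1 * (1 + ∑' h : ℕ, ((h : ℝ) + 1) * μ⁻¹ ^ h), ?_, fun n => ?_⟩
  · have : 0 ≤ ∑' h : ℕ, ((h : ℝ) + 1) * μ⁻¹ ^ h := tsum_nonneg fun h => by positivity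
    positivity
  have hterm : ∀ k ∈ range (n + 1), μ ^ k * pathWeight (fun n k => k ≤ n) n k ≤
      Real.exp 1 * (μ * Real.exp 1) ^ n * ballotDecay n *
        (((n - k : ℕ) : ℝ) + 1) * μ⁻¹ ^ (n - k) := by
    intro k hk
    have hk' : k ≤ n := by simpa [Nat.lt_succ_iff] using hk
    have h1 := pathWeight_le_abelCoeff hk'
    rw [abelCoeff_eq (by omega)] at h1
    push_cast at h1
    have h2 := pow_div_factorial_le_of_le hk'
    have h3 := sqrt_mul_self_pow_le (n + 1)
    have h4 : ((n : ℝ) + 1) ^ n / (n.factorial : ℝ) ≤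
        Real.exp 1 * Real.exp 1 ^ n / √((n : ℝ) + 1) := by
      rw [div_le_div_iff₀ (by positivity) (by positivity)]
      rw [Nat.factorial_succ] at h3
      push_cast at h3
      have h5 : ((n : ℝ) + 1) * (((n : ℝ) + 1) ^ n * √((n : ℝ) + 1)) ≤
        ((n : ℝ) + 1) * (Real.exp 1 * Real.exp 1 ^ n * n.factorial) := by
        calc _ = √((n : ℝ) + 1) * ((n : ℝ) + 1) ^ (n + 1) := by ring
          _ ≤ _ := h3
          _ = _ := by ring
      exact le_of_mul_le_mul_left h5 (by positivity)
    have hnk : (0 : ℝ) ≤ (n : ℝ) + 1 - k := by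
      have : (k : ℝ) ≤ n := by exact_mod_cast hk'
      linarith
    have hμk : μ ^ k = μ ^ n * μ⁻¹ ^ (n - k) := by
      obtain ⟨j, rfl⟩ := Nat.exists_eq_add_of_le hk'
      rw [Nat.add_sub_cancel_left, pow_add, mul_assoc, ← mul_pow, mul_inv_cancel₀ hμ0.ne',
        one_pow, mul_one]
    rw [hμk, Nat.cast_sub hk']
    calc μ ^ n * μ⁻¹ ^ (n - k) * pathWeight (fun n k => k ≤ n) n k
        ≤ μ ^ n * μ⁻¹ ^ (n - k) * ((Real.exp 1 * Real.exp 1 ^ n / √((n : ℝ) + 1)) *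
          (((n : ℝ) + 1 - k) / ((n : ℝ) + 1))) := by
          gcongr
          exact h1.trans (mul_le_mul_of_nonneg_right (h2.trans h4) (by positivity))
      _ = _ := by
          unfold ballotDecay
          rw [mul_pow]
          field_simp
          ring
  refine (Finset.sum_le_sum hterm).trans ?_
  have hrefl := Finset.sum_range_reflect (fun h : ℕ => ((h : ℝ) + 1) * μ⁻¹ ^ h) (n + 1)
  simp only [Nat.add_sub_cancel] at hrefl
  simp only [mul_assoc (Real.exp 1 * (μ * Real.exp 1) ^ n * ballotDecay n)]
  rw [← Finset.mul_sum]
  have h6 : ∑ k ∈ range (n + 1), (((n - k : ℕ) : ℝ) + 1) * μ⁻¹ ^ (n - k) ≤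
      1 + ∑' h : ℕ, ((h : ℝ) + 1) * μ⁻¹ ^ h := by
    have h7 := hs.sum_le_tsum (range (n + 1)) (fun h _ => by positivity)
    rw [← hrefl] at h7
    linarith
  have := ballotDecay_pos n
  calc _ ≤ Real.exp 1 * (μ * Real.exp 1) ^ n * ballotDecay n *
        (1 + ∑' h : ℕ, ((h : ℝ) + 1) * μ⁻¹ ^ h) := by gcongr
    _ = _ := by ring

lemma pathWeight_ge_le (n h k : ℕ) (hk : k + 1 = n + h) :
    pathWeight (fun n k => n ≤ k + 1) n k ≤
      4 * Real.exp 1 ^ 3 * Real.exp 1 ^ n * ballotDecay n *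
        (√((h : ℝ) + 1) * (Real.exp 1 / 2) ^ h) := by
  have h1 := sum_pathWeight_mul_abelCoeff_le n (2 * h)
  have hmem : ((k, h + 1) : ℕ × ℕ) ∈ antidiagonal (n + 2 * h) := by
    rw [HasAntidiagonal.mem_antidiagonal]; simp only; omega
  have h2 : pathWeight (fun n k => n ≤ k + 1) n k * abelCoeff (2 * h + 2) (h + 1) ≤
      abelCoeff (n + 2 * h + 2) (n + 2 * h) := by
    refine le_trans ?_ h1
    refine Finset.single_le_sum (f := fun x : ℕ × ℕ =>
      pathWeight (fun n k => n ≤ k + 1) n x.1 * abelCoeff (2 * h + 2) x.2) ?_ hmem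
    intro x hx
    rw [HasAntidiagonal.mem_antidiagonal] at hx
    by_cases hx1 : n ≤ x.1 + 1
    · exact mul_nonneg (pathWeight_nonneg _ _ _) (abelCoeff_nonneg (by omega) (by omega))
    · rw [pathWeight_eq_zero (ok := fun n k => n ≤ k + 1) (by simp) hx1, zero_mul]
  have h3 : abelCoeff (n + 2 * h + 2) (n + 2 * h) ≤
      2 * Real.exp 1 ^ 2 * Real.exp 1 ^ n * ballotDecay n * Real.exp 1 ^ (2 * h) := by
    rw [abelCoeff_eq (by omega)]
    set N := n + 2 * h with hN
    have h4 := pow_div_factorial_le_of_le (show N ≤ N + 1 by omega)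
    have h5 := sqrt_mul_self_pow_le (N + 2)
    have e1 : ((N + 2 : ℕ) : ℝ) ^ N / (N.factorial : ℝ) ≤
        Real.exp 1 ^ (N + 2) / √((N : ℝ) + 2) := by
      rw [le_div_iff₀ (by positivity), div_mul_eq_mul_div, div_le_iff₀ (by positivity)]
      rw [Nat.factorial_succ, Nat.factorial_succ] at h5
      push_cast at h5 ⊢
      have hp : (0 : ℝ) < ((N : ℝ) + 2) ^ 2 := by positivity
      refine le_of_mul_le_mul_left ?_ hp
      calc ((N : ℝ) + 2) ^ 2 * (((N : ℝ) + 2) ^ N * √((N : ℝ) + 2))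
          = √((N : ℝ) + 2) * ((N : ℝ) + 2) ^ (N + 2) := by ring
        _ ≤ _ := h5
        _ ≤ ((N : ℝ) + 2) ^ 2 * (Real.exp 1 ^ (N + 2) * (N.factorial : ℝ)) := by
            have : ((N : ℝ) + 1 + 1) * (((N : ℝ) + 1) * N.factorial) ≤
              ((N : ℝ) + 2) ^ 2 * N.factorial := by
              have : (0 : ℝ) < N.factorial := by positivity
              nlinarith
            calc _ ≤ (((N : ℝ) + 2) ^ 2 * N.factorial) * Real.exp 1 ^ (N + 2) := by gcongr
              _ = _ := by ring
    have e2 : 2 / (√((N : ℝ) + 2) * ((N : ℝ) + 2)) ≤ 2 * ballotDecay n := by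
      unfold ballotDecay
      have hNn : (n : ℝ) ≤ N := by exact_mod_cast (by omega : n ≤ N)
      rw [mul_one_div, mul_comm (√((N : ℝ) + 2))]
      gcongr <;> linarith
    calc ((N + 2 : ℕ) : ℝ) ^ N / (N.factorial : ℝ) * ((((N + 2 : ℕ) : ℝ) - N) / ((N + 2 : ℕ) : ℝ))
        ≤ Real.exp 1 ^ (N + 2) / √((N : ℝ) + 2) *
          ((((N + 2 : ℕ) : ℝ) - N) / ((N + 2 : ℕ) : ℝ)) := by
          refine mul_le_mul_of_nonneg_right e1 ?_
          push_cast
          have : (0 : ℝ) ≤ (N : ℝ) + 2 - N := by linarith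
          positivity
      _ = Real.exp 1 ^ (N + 2) * (2 / (√((N : ℝ) + 2) * ((N : ℝ) + 2))) := by
          push_cast
          field_simp
          ring
      _ ≤ Real.exp 1 ^ (N + 2) * (2 * ballotDecay n) := by gcongr
      _ = _ := by rw [hN]; ring
  have h6 : 1 ≤ abelCoeff (2 * h + 2) (h + 1) *
      (2 * Real.exp 1 * √((h : ℝ) + 1) * (1 / (2 * Real.exp 1)) ^ h) := by
    have hf := factorial_succ_le h
    rw [abelCoeff_eq (by omega)]
    push_cast
    have hfp : (0 : ℝ) < ((h + 1).factorial : ℝ) := by positivity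
    have e3 : (2 * (h : ℝ) + 2) ^ (h + 1) / ((h + 1).factorial : ℝ) *
        ((2 * (h : ℝ) + 2 - ((h : ℝ) + 1)) / (2 * (h : ℝ) + 2)) *
        (2 * Real.exp 1 * √((h : ℝ) + 1) * (1 / (2 * Real.exp 1)) ^ h) =
        2 * (Real.exp 1 * √((h : ℝ) + 1) * (((h : ℝ) + 1) / Real.exp 1) ^ (h + 1)) * Real.exp 1 /
          ((h + 1).factorial : ℝ) := by
      have e4 : 2 * (h : ℝ) + 2 = 2 * ((h : ℝ) + 1) := by ring
      rw [e4, mul_pow, div_pow, div_pow, mul_pow, one_pow, pow_succ 2 h, pow_succ (Real.exp 1) h]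
      have hh : (h : ℝ) + 1 ≠ 0 := by positivity
      have he : Real.exp 1 ≠ 0 := by positivity
      field_simp
      ring
    rw [e3, le_div_iff₀ hfp, one_mul]
    refine hf.trans ?_
    have he : (1 : ℝ) ≤ Real.exp 1 := Real.one_le_exp (by norm_num)
    have hX : 0 ≤ Real.exp 1 * √((h : ℝ) + 1) * (((h : ℝ) + 1) / Real.exp 1) ^ (h + 1) := by
      positivity
    nlinarith
  have hV := pathWeight_nonneg (fun n k => n ≤ k + 1) n k
  have hb := ballotDecay_pos n
  calc pathWeight (fun n k => n ≤ k + 1) n k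
      ≤ pathWeight (fun n k => n ≤ k + 1) n k * (abelCoeff (2 * h + 2) (h + 1) *
      (2 * Real.exp 1 * √((h : ℝ) + 1) * (1 / (2 * Real.exp 1)) ^ h)) :=
        le_mul_of_one_le_right hV h6
    _ = (pathWeight (fun n k => n ≤ k + 1) n k * abelCoeff (2 * h + 2) (h + 1)) *
      (2 * Real.exp 1 * √((h : ℝ) + 1) * (1 / (2 * Real.exp 1)) ^ h) := by ring
    _ ≤ (2 * Real.exp 1 ^ 2 * Real.exp 1 ^ n * ballotDecay n * Real.exp 1 ^ (2 * h)) *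
      (2 * Real.exp 1 * √((h : ℝ) + 1) * (1 / (2 * Real.exp 1)) ^ h) := by
        exact mul_le_mul_of_nonneg_right (h2.trans h3) (by positivity)
    _ = _ := by
        have : (Real.exp 1 / 2) ^ h = Real.exp 1 ^ (2 * h) * (1 / (2 * Real.exp 1)) ^ h := by
          rw [pow_mul, ← mul_pow]
          congr 1
          have : Real.exp 1 ≠ 0 := by positivity
          field_simp
        rw [this]
        ring

lemma exists_sum_pathWeight_ge_le :
    ∃ C > 0, ∀ n M : ℕ,
      ∑ k ∈ range M, (Real.log 2) ^ k * pathWeight (fun n k => n ≤ k + 1) n k ≤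
        C * (Real.log 2 * Real.exp 1) ^ n * ballotDecay n := by
  set l := Real.log 2 with hl
  have hl0 : 0 < l := Real.log_pos (by norm_num)
  have hr : ‖l * (Real.exp 1 / 2)‖ < 1 := by
    rw [Real.norm_of_nonneg (by positivity)]
    have h1 := Real.log_two_lt_d9
    have h2 := Real.exp_one_lt_d9
    rw [← hl] at h1
    nlinarith [Real.exp_pos 1]
  have hs : Summable fun h : ℕ => √((h : ℝ) + 1) * (l * (Real.exp 1 / 2)) ^ h := by
    have h1 := summable_pow_mul_geometric_of_norm_lt_one 1 hr
    have h0 := summable_geometric_of_norm_lt_one hr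
    refine Summable.of_nonneg_of_le (fun h => by positivity) (fun h => ?_) (h1.add h0)
    have : √((h : ℝ) + 1) ≤ (h : ℝ) + 1 := by
      rw [Real.sqrt_le_left (by positivity)]
      nlinarith [(Nat.cast_nonneg h : (0 : ℝ) ≤ h)]
    calc _ ≤ ((h : ℝ) + 1) * (l * (Real.exp 1 / 2)) ^ h := by gcongr
      _ = _ := by ring
  set T := ∑' h : ℕ, √((h : ℝ) + 1) * (l * (Real.exp 1 / 2)) ^ h with hT
  have hT0 : 0 ≤ T := tsum_nonneg fun h => by positivity
  refine ⟨4 * Real.exp 1 ^ 3 * l⁻¹ * (1 + T), by positivity, fun n M => ?_⟩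
  have hb := ballotDecay_pos n
  set c := 4 * Real.exp 1 ^ 3 * l⁻¹ * (l * Real.exp 1) ^ n * ballotDecay n with hc
  have hc0 : 0 ≤ c := by positivity
  calc ∑ k ∈ range M, l ^ k * pathWeight (fun n k => n ≤ k + 1) n k
      = ∑ k ∈ (range M).filter (fun k => n ≤ k + 1),
          l ^ k * pathWeight (fun n k => n ≤ k + 1) n k := by
        rw [Finset.sum_filter]
        refine Finset.sum_congr rfl fun k _ => ?_
        split_ifs with h
        · rfl
        · rw [pathWeight_eq_zero (ok := fun n k => n ≤ k + 1) (by simp) h, mul_zero]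
    _ ≤ ∑ k ∈ (range M).filter (fun k => n ≤ k + 1),
          c * (√(((k + 1 - n : ℕ) : ℝ) + 1) * (l * (Real.exp 1 / 2)) ^ (k + 1 - n)) := by
        refine Finset.sum_le_sum fun k hk => ?_
        rw [Finset.mem_filter] at hk
        obtain ⟨h, hh⟩ := Nat.exists_eq_add_of_le hk.2
        rw [hh, Nat.add_sub_cancel_left]
        have h1 := pathWeight_ge_le n h k hh
        have h2 : l ^ k = l⁻¹ * l ^ n * l ^ h := by
          have : l ^ (k + 1) = l ^ n * l ^ h := by rw [hh, pow_add]
          rw [pow_succ] at this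
          field_simp
          linarith
        calc _ ≤ l ^ k * (4 * Real.exp 1 ^ 3 * Real.exp 1 ^ n * ballotDecay n *
                (√((h : ℝ) + 1) * (Real.exp 1 / 2) ^ h)) := by gcongr
          _ = _ := by rw [h2, hc, mul_pow, mul_pow]; ring
    _ = c * ∑ k ∈ (range M).filter (fun k => n ≤ k + 1),
          (√(((k + 1 - n : ℕ) : ℝ) + 1) * (l * (Real.exp 1 / 2)) ^ (k + 1 - n)) := by
        rw [Finset.mul_sum]
    _ ≤ c * (1 + T) := by
        gcongr
        have hinj : Set.InjOn (fun k => k + 1 - n) ((range M).filter (fun k => n ≤ k + 1)) := by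
          intro a ha b hb hab
          simp only [Finset.coe_filter, Set.mem_ofPred_eq] at ha hb hab
          omega
        have := Finset.sum_image
          (f := fun h : ℕ => √((h : ℝ) + 1) * (l * (Real.exp 1 / 2)) ^ h) hinj
        rw [← this]
        have := hs.sum_le_tsum (((range M).filter (fun k => n ≤ k + 1)).image fun k => k + 1 - n)
          (fun h _ => by positivity)
        linarith
    _ = _ := by rw [hc]; ring

end

section
open Finset

variable {ι : Type*} [DecidableEq ι]

lemma sum_powersetCard_prod_le (w : ι → ℝ) (hw : ∀ p, 0 ≤ w p) (A : Finset ι) (b : ℕ) :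
    ∑ S ∈ A.powersetCard b, ∏ p ∈ S, w p ≤ (∑ p ∈ A, w p) ^ b / (b.factorial : ℝ) := by
  induction A using Finset.induction_on generalizing b with
  | empty =>
    cases b with
    | zero => simp
    | succ b => rw [Finset.powersetCard_eq_empty.mpr (by simp)]; simp
  | insert a A ha ih =>
    cases b with
    | zero => simp
    | succ b =>
      have hx : 0 ≤ ∑ p ∈ A, w p := Finset.sum_nonneg fun p _ => hw p
      have hinj : Set.InjOn (insert a) (A.powersetCard b : Set (Finset ι)) := by
        intro S hS T hT hST
        rw [Finset.mem_coe, Finset.mem_powersetCard] at hS hT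
        rw [← Finset.erase_insert (fun h => ha (hS.1 h)), hST,
          Finset.erase_insert (fun h => ha (hT.1 h))]
      have hdisj : Disjoint (A.powersetCard (b + 1)) ((A.powersetCard b).image (insert a)) := by
        rw [Finset.disjoint_left]
        intro S hS hS'
        rw [Finset.mem_powersetCard] at hS
        obtain ⟨T, -, rfl⟩ := Finset.mem_image.mp hS'
        exact ha (hS.1 (Finset.mem_insert_self _ _))
      rw [Finset.powersetCard_succ_insert ha, Finset.sum_union hdisj, Finset.sum_image hinj,
        Finset.sum_insert ha]
      have h1 : ∑ S ∈ A.powersetCard b, ∏ p ∈ insert a S, w p =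
          w a * ∑ S ∈ A.powersetCard b, ∏ p ∈ S, w p := by
        rw [Finset.mul_sum]
        refine Finset.sum_congr rfl fun S hS => ?_
        rw [Finset.mem_powersetCard] at hS
        rw [Finset.prod_insert fun h => ha (hS.1 h)]
      rw [h1]
      set x := ∑ p ∈ A, w p with hxd
      have h2 : x ^ (b + 1) + ((b : ℝ) + 1) * x ^ b * w a ≤ (w a + x) ^ (b + 1) := by
        have hwa := hw a
        clear_value x
        clear ih h1 hinj hdisj
        induction b with
        | zero => simp; linarith
        | succ b ihb =>
          push_cast
          calc x ^ (b + 1 + 1) + ((b : ℝ) + 1 + 1) * x ^ (b + 1) * w a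
              ≤ (w a + x) * (x ^ (b + 1) + ((b : ℝ) + 1) * x ^ b * w a) := by
                have : 0 ≤ ((b : ℝ) + 1) * x ^ b * (w a) ^ 2 := by positivity
                linarith [show (w a + x) * (x ^ (b + 1) + ((b : ℝ) + 1) * x ^ b * w a) =
                  x ^ (b + 1 + 1) + ((b : ℝ) + 1 + 1) * x ^ (b + 1) * w a +
                  ((b : ℝ) + 1) * x ^ b * (w a) ^ 2 by ring]
            _ ≤ (w a + x) * (w a + x) ^ (b + 1) := by gcongr
            _ = _ := by ring
      have h3 : (0 : ℝ) < (b.factorial : ℝ) := by positivity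
      calc _ ≤ x ^ (b + 1) / ((b + 1).factorial : ℝ) + w a * (x ^ b / (b.factorial : ℝ)) := by
            have := hw a
            gcongr
            · exact ih _
            · exact ih _
        _ = (x ^ (b + 1) + ((b : ℝ) + 1) * x ^ b * w a) / ((b + 1).factorial : ℝ) := by
            rw [Nat.factorial_succ]
            push_cast
            have : (b : ℝ) + 1 ≠ 0 := by positivity
            field_simp
        _ ≤ _ := by gcongr

lemma sum_powerset_union {M : Type*} [AddCommMonoid M] {A B : Finset ι} (h : Disjoint A B)
    (f : Finset ι → M) :
    ∑ S ∈ (A ∪ B).powerset, f S = ∑ S ∈ A.powerset, ∑ T ∈ B.powerset, f (S ∪ T) := by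
  rw [← Finset.sum_product']
  symm
  refine Finset.sum_nbij' (fun x => x.1 ∪ x.2) (fun S => (S ∩ A, S ∩ B)) ?_ ?_ ?_ ?_ ?_
  · intro x hx
    rw [Finset.mem_product, Finset.mem_powerset, Finset.mem_powerset] at hx
    exact Finset.mem_powerset.mpr (Finset.union_subset_union hx.1 hx.2)
  · intro S _
    simp
  · intro x hx
    rw [Finset.mem_product, Finset.mem_powerset, Finset.mem_powerset] at hx
    have h1 : x.2 ∩ A = ∅ := by
      rw [← Finset.disjoint_iff_inter_eq_empty]
      exact (h.mono_right hx.2).symm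
    have h2 : x.1 ∩ B = ∅ := by
      rw [← Finset.disjoint_iff_inter_eq_empty]
      exact h.mono_left hx.1
    ext1
    · simp only [Finset.union_inter_distrib_right, h1, Finset.union_empty,
        Finset.inter_eq_left.mpr hx.1]
    · simp only [Finset.union_inter_distrib_right, h2, Finset.empty_union,
        Finset.inter_eq_left.mpr hx.2]
  · intro S hS
    simp only
    rw [← Finset.inter_union_distrib_left]
    exact Finset.inter_eq_left.mpr (Finset.mem_powerset.mp hS)
  · intro x _
    rfl

lemma disjoint_biUnion_range {P : ℕ → Finset ι} (hP : Pairwise (Function.onFun Disjoint P))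
    {i n : ℕ} (hi : i ≤ n) : Disjoint ((range i).biUnion P) (P n) := by
  rw [Finset.disjoint_biUnion_left]
  intro j hj
  exact hP (by have := Finset.mem_range.mp hj; omega)

open Classical in
lemma sum_filter_card_le {P : ℕ → Finset ι} (hP : Pairwise (Function.onFun Disjoint P))
    {w : ι → ℝ} (hw : ∀ p, 0 ≤ w p) {l : ℝ} (hl : 0 ≤ l) (hsum : ∀ j, ∑ p ∈ P j, w p ≤ l)
    (ok : ℕ → ℕ → Prop) (n k : ℕ) :
    ∑ S ∈ ((range n).biUnion P).powerset with
      (∀ i ≤ n, ok i (S ∩ (range i).biUnion P).card) ∧ S.card = k, ∏ p ∈ S, w p ≤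
        l ^ k * pathWeight ok n k := by
  induction n generalizing k with
  | zero =>
    rw [pathWeight]
    split_ifs with hk
    · subst hk
      rw [Finset.range_zero, Finset.biUnion_empty, Finset.powerset_empty, pow_zero, one_mul,
        Finset.sum_filter, Finset.sum_singleton]
      split_ifs <;> simp
    · rw [mul_zero]
      refine le_of_eq (Finset.sum_eq_zero fun S hS => ?_)
      simp only [Finset.range_zero, Finset.biUnion_empty, Finset.powerset_empty,
        Finset.mem_filter, Finset.mem_singleton] at hS
      obtain ⟨rfl, -, h⟩ := hS
      exact absurd h.symm hk
  | succ n ih =>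
    have hU : (range (n + 1)).biUnion P = (range n).biUnion P ∪ P n := by
      rw [Finset.range_add_one, Finset.biUnion_insert, Finset.union_comm]
    have hd := disjoint_biUnion_range hP (le_refl n)
    have hprod : ∀ S : Finset ι, 0 ≤ ∏ p ∈ S, w p := fun S => Finset.prod_nonneg fun p _ => hw p
    by_cases hk : ok (n + 1) k
    swap
    · rw [pathWeight, if_neg hk, mul_zero]
      refine le_of_eq (Finset.sum_eq_zero fun S hS => ?_)
      rw [Finset.mem_filter, Finset.mem_powerset] at hS
      have := hS.2.1 (n + 1) le_rfl
      rw [Finset.inter_eq_left.mpr hS.1, hS.2.2] at this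
      exact absurd this hk
    rw [pathWeight, if_pos hk, Finset.sum_filter, hU, sum_powerset_union hd]
    calc _ ≤ ∑ S ∈ ((range n).biUnion P).powerset, ∑ T ∈ (P n).powerset,
          ∑ x ∈ antidiagonal k,
            (if (∀ i ≤ n, ok i (S ∩ (range i).biUnion P).card) ∧ S.card = x.1 then
              ∏ p ∈ S, w p else 0) * (if T.card = x.2 then ∏ p ∈ T, w p else 0) := by
          refine Finset.sum_le_sum fun S hS => Finset.sum_le_sum fun T hT => ?_
          rw [Finset.mem_powerset] at hS hT
          have hST : Disjoint S T := hd.mono hS hT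
          have hnn : ∀ x ∈ antidiagonal k, 0 ≤
            (if (∀ i ≤ n, ok i (S ∩ (range i).biUnion P).card) ∧ S.card = x.1 then
              ∏ p ∈ S, w p else 0) * (if T.card = x.2 then ∏ p ∈ T, w p else 0) := by
            intro x _
            refine mul_nonneg ?_ ?_
            · split_ifs
              · exact hprod S
              · exact le_rfl
            · split_ifs
              · exact hprod T
              · exact le_rfl
          split_ifs with hc
          · obtain ⟨h1, h2⟩ := hc
            have hmem : (S.card, T.card) ∈ antidiagonal k := by
              rw [HasAntidiagonal.mem_antidiagonal, ← h2, Finset.card_union_of_disjoint hST]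
            refine le_trans (le_of_eq ?_) (Finset.single_le_sum hnn hmem)
            rw [if_pos, if_pos rfl, Finset.prod_union hST]
            refine ⟨fun i hi => ?_, rfl⟩
            have h3 := h1 i (by omega)
            have h4 : T ∩ (range i).biUnion P = ∅ := by
              rw [← Finset.disjoint_iff_inter_eq_empty]
              exact ((disjoint_biUnion_range hP hi).mono_right hT).symm
            rwa [Finset.union_inter_distrib_right, h4, Finset.union_empty] at h3
          · exact Finset.sum_nonneg hnn
      _ = ∑ x ∈ antidiagonal k, (∑ S ∈ ((range n).biUnion P).powerset with
            (∀ i ≤ n, ok i (S ∩ (range i).biUnion P).card) ∧ S.card = x.1, ∏ p ∈ S, w p) *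
            ∑ T ∈ (P n).powersetCard x.2, ∏ p ∈ T, w p := by
          have h1 : ∀ S ∈ ((range n).biUnion P).powerset, (∑ T ∈ (P n).powerset,
            ∑ x ∈ antidiagonal k,
            (if (∀ i ≤ n, ok i (S ∩ (range i).biUnion P).card) ∧ S.card = x.1 then
              ∏ p ∈ S, w p else 0) * (if T.card = x.2 then ∏ p ∈ T, w p else 0)) =
            ∑ x ∈ antidiagonal k, ∑ T ∈ (P n).powerset,
            (if (∀ i ≤ n, ok i (S ∩ (range i).biUnion P).card) ∧ S.card = x.1 then
              ∏ p ∈ S, w p else 0) * (if T.card = x.2 then ∏ p ∈ T, w p else 0) :=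
            fun S _ => Finset.sum_comm
          rw [Finset.sum_congr rfl h1, Finset.sum_comm]
          refine Finset.sum_congr rfl fun x _ => ?_
          rw [Finset.sum_filter, Finset.powersetCard_eq_filter, Finset.sum_filter,
            Finset.sum_mul_sum]
      _ ≤ ∑ x ∈ antidiagonal k, (l ^ x.1 * pathWeight ok n x.1) *
            (l ^ x.2 / (x.2.factorial : ℝ)) := by
          refine Finset.sum_le_sum fun x _ => ?_
          refine mul_le_mul (ih _) ?_ (Finset.sum_nonneg fun T _ => hprod T)
            (mul_nonneg (by positivity) (pathWeight_nonneg _ _ _))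
          refine (sum_powersetCard_prod_le w hw _ _).trans ?_
          have : 0 ≤ ∑ p ∈ P n, w p := Finset.sum_nonneg fun p _ => hw p
          gcongr
          exact hsum n
      _ = _ := by
          rw [Finset.mul_sum]
          refine Finset.sum_congr rfl fun x hx => ?_
          rw [HasAntidiagonal.mem_antidiagonal] at hx
          rw [← hx, pow_add]
          ring

open Classical in
lemma exists_sum_le_card_le : ∃ C > 0, ∀ {P : ℕ → Finset ι}
    (_ : Pairwise (Function.onFun Disjoint P)) {w : ι → ℝ} (_ : ∀ p, 0 ≤ w p)
    (_ : ∀ j, ∑ p ∈ P j, w p ≤ Real.log 2) (n : ℕ),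
    ∑ S ∈ ((range n).biUnion P).powerset with
      (∀ i ≤ n, (S ∩ (range i).biUnion P).card ≤ i), 2 ^ S.card * ∏ p ∈ S, w p ≤
        C * (2 * Real.log 2 * Real.exp 1) ^ n * ballotDecay n := by
  obtain ⟨C, hC, h⟩ := exists_sum_pathWeight_le_le
  refine ⟨C, hC, fun {P} hP {w} hw hsum n => le_trans ?_ (h n)⟩
  have hmap : ∀ S ∈ ((range n).biUnion P).powerset.filter
      (fun S => ∀ i ≤ n, (S ∩ (range i).biUnion P).card ≤ i), S.card ∈ range (n + 1) := by
    intro S hS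
    rw [Finset.mem_filter, Finset.mem_powerset] at hS
    have := hS.2 n le_rfl
    rw [Finset.inter_eq_left.mpr hS.1] at this
    rw [Finset.mem_range]; omega
  rw [← Finset.sum_fiberwise_of_maps_to hmap]
  refine Finset.sum_le_sum fun k _ => ?_
  have h1 := sum_filter_card_le hP hw (Real.log_nonneg one_le_two) hsum (fun n k => k ≤ n) n k
  rw [Finset.filter_filter]
  calc _ = 2 ^ k * ∑ S ∈ ((range n).biUnion P).powerset with
      (∀ i ≤ n, (S ∩ (range i).biUnion P).card ≤ i) ∧ S.card = k, ∏ p ∈ S, w p := by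
        rw [Finset.mul_sum]
        refine Finset.sum_congr rfl fun S hS => ?_
        rw [(Finset.mem_filter.mp hS).2.2]
    _ ≤ 2 ^ k * (Real.log 2 ^ k * pathWeight (fun n k => k ≤ n) n k) := by
        refine mul_le_mul_of_nonneg_left ?_ (by positivity)
        refine le_trans (le_of_eq (Finset.sum_congr ?_ fun _ _ => rfl)) h1
        ext S
        simp only [Finset.mem_filter]
    _ = _ := by rw [mul_pow]; ring

open Classical in
lemma exists_sum_card_ge_le : ∃ C > 0, ∀ {P : ℕ → Finset ι}
    (_ : Pairwise (Function.onFun Disjoint P)) {w : ι → ℝ} (_ : ∀ p, 0 ≤ w p)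
    (_ : ∀ j, ∑ p ∈ P j, w p ≤ Real.log 2) (n : ℕ),
    ∑ S ∈ ((range n).biUnion P).powerset with
      (∀ i ≤ n, i ≤ (S ∩ (range i).biUnion P).card + 1), ∏ p ∈ S, w p ≤
        C * (Real.log 2 * Real.exp 1) ^ n * ballotDecay n := by
  obtain ⟨C, hC, h⟩ := exists_sum_pathWeight_ge_le
  refine ⟨C, hC, fun {P} hP {w} hw hsum n =>
    le_trans ?_ (h n (((range n).biUnion P).card + 1))⟩
  have hmap : ∀ S ∈ ((range n).biUnion P).powerset.filter
      (fun S => ∀ i ≤ n, i ≤ (S ∩ (range i).biUnion P).card + 1),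
      S.card ∈ range (((range n).biUnion P).card + 1) := by
    intro S hS
    rw [Finset.mem_filter, Finset.mem_powerset] at hS
    have := Finset.card_le_card hS.1
    rw [Finset.mem_range]; omega
  rw [← Finset.sum_fiberwise_of_maps_to hmap]
  refine Finset.sum_le_sum fun k _ => ?_
  rw [Finset.filter_filter]
  refine le_trans (le_of_eq (Finset.sum_congr ?_ fun _ _ => rfl))
    (sum_filter_card_le hP hw (Real.log_nonneg one_le_two) hsum (fun n k => n ≤ k + 1) n k)
  ext S
  simp only [Finset.mem_filter]

open Classical in
lemma sum_one_add_sum_mul_prod_le (U : Finset ι) {w ℓ : ι → ℝ} (hw : ∀ p, 0 ≤ w p)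
    (hℓ : ∀ p, 0 ≤ ℓ p) (V : ℕ → Finset ι) (n : ℕ) :
    ∑ S ∈ U.powerset with (∀ i ≤ n, i ≤ (S ∩ V i).card), (1 + ∑ p ∈ S, ℓ p) * ∏ p ∈ S, w p ≤
      (1 + ∑ p ∈ U, ℓ p * w p) *
        ∑ S ∈ U.powerset with (∀ i ≤ n, i ≤ (S ∩ V i).card + 1), ∏ p ∈ S, w p := by
  have hprod : ∀ S : Finset ι, 0 ≤ ∏ p ∈ S, w p := fun S => Finset.prod_nonneg fun p _ => hw p
  simp only [add_mul, one_mul, Finset.sum_add_distrib]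
  refine add_le_add ?_ ?_
  · refine Finset.sum_le_sum_of_subset_of_nonneg ?_ fun S _ _ => hprod S
    intro S hS
    rw [Finset.mem_filter] at hS ⊢
    exact ⟨hS.1, fun i hi => (hS.2 i hi).trans (Nat.le_succ _)⟩
  · calc _ = ∑ S ∈ U.powerset with (∀ i ≤ n, i ≤ (S ∩ V i).card), ∑ p ∈ U,
          if p ∈ S then ℓ p * ∏ q ∈ S, w q else 0 := by
          refine Finset.sum_congr rfl fun S hS => ?_
          rw [Finset.mem_filter, Finset.mem_powerset] at hS
          rw [← Finset.sum_filter, Finset.filter_mem_eq_inter, Finset.inter_eq_right.mpr hS.1,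
            Finset.sum_mul]
      _ = ∑ p ∈ U, ∑ S ∈ U.powerset with (∀ i ≤ n, i ≤ (S ∩ V i).card),
          if p ∈ S then ℓ p * ∏ q ∈ S, w q else 0 := Finset.sum_comm
      _ ≤ _ := by
          rw [Finset.sum_mul]
          refine Finset.sum_le_sum fun p _ => ?_
          rw [← Finset.sum_filter, mul_assoc, ← Finset.mul_sum]
          refine mul_le_mul_of_nonneg_left ?_ (hℓ p)
          rw [Finset.mul_sum]
          have hinj : Set.InjOn (fun S : Finset ι => S.erase p)
              ((U.powerset.filter (fun S => ∀ i ≤ n, i ≤ (S ∩ V i).card)).filter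
                (fun S => p ∈ S)) := by
            intro S hS T hT hST
            simp only [Finset.coe_filter, Set.mem_ofPred_eq] at hS hT
            simp only at hST
            rw [← Finset.insert_erase hS.2, hST, Finset.insert_erase hT.2]
          calc _ = ∑ S ∈ ((U.powerset.filter (fun S => ∀ i ≤ n, i ≤ (S ∩ V i).card)).filter
                (fun S => p ∈ S)), w p * ∏ q ∈ S.erase p, w q := by
                refine Finset.sum_congr rfl fun S hS => ?_
                rw [Finset.mul_prod_erase _ _ (Finset.mem_filter.mp hS).2]
            _ = ∑ S ∈ ((U.powerset.filter (fun S => ∀ i ≤ n, i ≤ (S ∩ V i).card)).filter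
                (fun S => p ∈ S)).image (fun S : Finset ι => S.erase p),
                  w p * ∏ q ∈ S, w q := by rw [Finset.sum_image hinj]
            _ ≤ _ := by
                refine Finset.sum_le_sum_of_subset_of_nonneg ?_
                  fun S _ _ => mul_nonneg (hw p) (hprod S)
                intro S hS
                obtain ⟨T, hT, rfl⟩ := Finset.mem_image.mp hS
                rw [Finset.mem_filter, Finset.mem_filter, Finset.mem_powerset] at hT
                rw [Finset.mem_filter, Finset.mem_powerset]
                refine ⟨(Finset.erase_subset _ _).trans hT.1.1, fun i hi => ?_⟩
                have h1 := hT.1.2 i hi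
                rw [Finset.erase_inter]
                have h2 := Finset.pred_card_le_card_erase (s := T ∩ V i) (a := p)
                omega

end

lemma summable_ballotDecay : Summable ballotDecay := by
  have h := (summable_nat_add_iff 1).mpr (Real.summable_one_div_nat_rpow.mpr
    (show (1 : ℝ) < 1 + 1 / 2 by norm_num))
  refine h.congr fun n => ?_
  rw [ballotDecay, Real.rpow_add (by positivity), Real.rpow_one, ← Real.sqrt_eq_rpow]
  push_cast
  rfl

lemma ballotDecay_le_of_le_two_mul {j n : ℕ} (h : n ≤ 2 * j) :
    ballotDecay j ≤ 4 * ballotDecay n := by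
  have h' : (n : ℝ) ≤ 2 * j := by exact_mod_cast h
  have h1 : √((n : ℝ) + 1) ≤ 2 * √((j : ℝ) + 1) := by
    rw [Real.sqrt_le_left (by positivity), mul_pow, Real.sq_sqrt (by positivity)]
    linarith
  rw [ballotDecay, ballotDecay, mul_one_div, div_le_div_iff₀ (by positivity) (by positivity)]
  nlinarith [mul_le_mul (show (n : ℝ) + 1 ≤ 2 * (j + 1) by linarith) h1 (by positivity)
    (by positivity)]

section
open Finset

lemma exists_sum_ballotDecay_mul_le : ∃ C > 0, ∀ n : ℕ,
    ∑ j ∈ range (n + 1), ballotDecay j * ballotDecay (n - j) ≤ C * ballotDecay n := by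
  have hpos : 0 < ∑' j, ballotDecay j :=
    summable_ballotDecay.tsum_pos (fun j => (ballotDecay_pos j).le) 0 (ballotDecay_pos 0)
  refine ⟨8 * ∑' j, ballotDecay j, by positivity, fun n => ?_⟩
  have hs := summable_ballotDecay.sum_le_tsum (range (n + 1)) fun j _ => (ballotDecay_pos j).le
  have hn := ballotDecay_pos n
  calc _ ≤ ∑ j ∈ range (n + 1), 4 * ballotDecay n * (ballotDecay j + ballotDecay (n - j)) := by
        refine Finset.sum_le_sum fun j hj => ?_
        have hj1 := ballotDecay_pos j
        have hj2 := ballotDecay_pos (n - j)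
        rcases le_total n (2 * j) with h | h
        · have := mul_le_mul_of_nonneg_right (ballotDecay_le_of_le_two_mul h) hj2.le
          nlinarith [mul_pos hn hj1]
        · have := mul_le_mul_of_nonneg_left
            (ballotDecay_le_of_le_two_mul (show n ≤ 2 * (n - j) by omega)) hj1.le
          nlinarith [mul_pos hn hj2]
    _ = 4 * ballotDecay n * (2 * ∑ j ∈ range (n + 1), ballotDecay j) := by
        rw [← Finset.mul_sum, Finset.sum_add_distrib]
        have := Finset.sum_range_reflect ballotDecay (n + 1)
        simp only [Nat.add_sub_cancel] at this
        rw [this, two_mul]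
    _ ≤ _ := by nlinarith

variable {ι : Type*} [DecidableEq ι]

open Classical in
lemma exists_sum_powerset_mul_prod_le : ∃ C > 0, ∀ {P : ℕ → Finset ι}
    (_ : Pairwise (Function.onFun Disjoint P)) {w ℓ : ι → ℝ} (_ : ∀ p, 0 ≤ w p)
    (_ : ∀ j, ∑ p ∈ P j, w p ≤ Real.log 2) (_ : ∀ p, 0 ≤ ℓ p) {K : ℝ} (_ : 0 ≤ K)
    (_ : ∀ j, ∀ p ∈ P j, ℓ p ≤ K * 2 ^ j) (n : ℕ) (G : Finset ι → ℝ)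
    (_ : ∀ j ≤ n, ∀ A ⊆ (range j).biUnion P,
      ∀ B ⊆ (range (n - j)).biUnion fun i => P (j + i),
        G (A ∪ B) ≤ 2 ^ B.card * (1 + ∑ p ∈ A, ℓ p)),
    ∑ S ∈ ((range n).biUnion P).powerset, G S * ∏ p ∈ S, w p ≤
      C * (1 + K) * (2 * Real.log 2 * Real.exp 1) ^ n * ballotDecay n := by
  obtain ⟨C₁, hC₁, h₁⟩ := exists_sum_le_card_le (ι := ι)
  obtain ⟨C₂, hC₂, h₂⟩ := exists_sum_card_ge_le (ι := ι)
  obtain ⟨C₃, hC₃, h₃⟩ := exists_sum_ballotDecay_mul_le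
  have hlog : 0 < Real.log 2 := Real.log_pos one_lt_two
  have hlog1 : Real.log 2 ≤ 1 := by linarith [Real.log_le_sub_one_of_pos two_pos]
  refine ⟨C₁ * C₂ * C₃, by positivity, fun {P} hP {w ℓ} hw hsum hℓ {K} hK hℓK n G hG => ?_⟩
  have hprod : ∀ S : Finset ι, 0 ≤ ∏ p ∈ S, w p := fun S => Finset.prod_nonneg fun p _ => hw p
  set U : ℕ → Finset ι := fun j => (range j).biUnion P with hU
  set R : ℕ → ℕ → Finset ι := fun j i => (range i).biUnion fun i => P (j + i) with hR
  set V : ℕ → ℕ → Finset ι := fun j i =>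
    (range i).biUnion fun i => if i < j then P (j - 1 - i) else ∅ with hV
  have hUmem : ∀ j p, p ∈ U j ↔ ∃ i < j, p ∈ P i := by intro j p; simp [hU]
  have hRmem : ∀ j i p, p ∈ R j i ↔ ∃ k < i, p ∈ P (j + k) := by intro j i p; simp [hR]
  have hVmem : ∀ j i p, p ∈ V j i ↔ ∃ k < i, k < j ∧ p ∈ P (j - 1 - k) := by
    intro j i p
    simp only [hV, Finset.mem_biUnion, Finset.mem_range]
    refine exists_congr fun k => and_congr_right fun _ => ?_
    split_ifs with h <;> simp [h]
  have hUR : ∀ j i, Disjoint (U j) (R j i) := by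
    intro j i
    rw [Finset.disjoint_left]
    intro p hp hp'
    obtain ⟨a, ha, hpa⟩ := (hUmem _ _).mp hp
    obtain ⟨b, hb, hpb⟩ := (hRmem _ _ _).mp hp'
    exact Finset.disjoint_left.mp (hP (show a ≠ j + b by omega)) hpa hpb
  have hVU : ∀ j, V j j = U j := by
    intro j
    ext p
    rw [hVmem, hUmem]
    constructor
    · rintro ⟨k, hk, -, hp⟩
      exact ⟨j - 1 - k, by omega, hp⟩
    · rintro ⟨k, hk, hp⟩
      refine ⟨j - 1 - k, by omega, by omega, ?_⟩
      rwa [show j - 1 - (j - 1 - k) = k by omega]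
  have hURn : ∀ j ≤ n, U n = U j ∪ R j (n - j) := by
    intro j hj
    ext p
    rw [Finset.mem_union, hUmem, hUmem, hRmem]
    constructor
    · rintro ⟨k, hk, hp⟩
      rcases lt_or_ge k j with h | h
      · exact Or.inl ⟨k, h, hp⟩
      · refine Or.inr ⟨k - j, by omega, ?_⟩
        rwa [show j + (k - j) = k by omega]
    · rintro (⟨k, hk, hp⟩ | ⟨k, hk, hp⟩)
      · exact ⟨k, by omega, hp⟩
      · exact ⟨j + k, by omega, hp⟩
  set F : ℕ → Finset ι → ℝ := fun j A => if ∀ i ≤ j, i ≤ (A ∩ V j i).card then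
    (1 + ∑ p ∈ A, ℓ p) * ∏ p ∈ A, w p else 0 with hF
  set H : ℕ → Finset ι → ℝ := fun j B => if ∀ i ≤ n - j, (B ∩ R j i).card ≤ i then
    2 ^ B.card * ∏ p ∈ B, w p else 0 with hH
  have hF0 : ∀ j A, 0 ≤ F j A := by
    intro j A
    simp only [hF]
    split_ifs
    · exact mul_nonneg (add_nonneg zero_le_one (Finset.sum_nonneg fun p _ => hℓ p)) (hprod A)
    · exact le_rfl
  have hH0 : ∀ j B, 0 ≤ H j B := by
    intro j B
    simp only [hH]
    split_ifs
    · exact mul_nonneg (by positivity) (hprod B)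
    · exact le_rfl
  have hsel : ∀ S ∈ (U n).powerset, G S * ∏ p ∈ S, w p ≤
      ∑ j ∈ range (n + 1), F j (S ∩ U j) * H j (S ∩ R j (n - j)) := by
    intro S hS
    rw [Finset.mem_powerset] at hS
    obtain ⟨j, hj, hmax⟩ := Finset.exists_max_image (range (n + 1))
      (fun j => ((S ∩ U j).card : ℤ) - j) ⟨0, by simp⟩
    have hjn : j ≤ n := by rw [Finset.mem_range] at hj; omega
    refine le_trans ?_ (Finset.single_le_sum
      (f := fun j => F j (S ∩ U j) * H j (S ∩ R j (n - j)))
      (fun j _ => mul_nonneg (hF0 _ _) (hH0 _ _)) hj)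
    have c1 : ∀ i ≤ j, i ≤ (S ∩ U j ∩ V j i).card := by
      intro i hi
      have h := hmax (j - i) (by rw [Finset.mem_range]; omega)
      have hsub : S ∩ U j ⊆ (S ∩ U (j - i)) ∪ (S ∩ U j ∩ V j i) := by
        intro p hp
        rw [Finset.mem_inter] at hp
        obtain ⟨k, hk, hpk⟩ := (hUmem _ _).mp hp.2
        rw [Finset.mem_union, Finset.mem_inter, Finset.mem_inter, Finset.mem_inter]
        rcases lt_or_ge k (j - i) with h | h
        · exact Or.inl ⟨hp.1, (hUmem _ _).mpr ⟨k, h, hpk⟩⟩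
        · refine Or.inr ⟨hp, (hVmem _ _ _).mpr ⟨j - 1 - k, by omega, by omega, ?_⟩⟩
          rwa [show j - 1 - (j - 1 - k) = k by omega]
      have h' := (Finset.card_le_card hsub).trans (Finset.card_union_le _ _)
      omega
    have c2 : ∀ i ≤ n - j, (S ∩ R j (n - j) ∩ R j i).card ≤ i := by
      intro i hi
      have h := hmax (j + i) (by rw [Finset.mem_range]; omega)
      have hsub : (S ∩ U j) ∪ (S ∩ R j (n - j) ∩ R j i) ⊆ S ∩ U (j + i) := by
        intro p hp
        rw [Finset.mem_union, Finset.mem_inter, Finset.mem_inter, Finset.mem_inter] at hp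
        rw [Finset.mem_inter, hUmem]
        rcases hp with ⟨h1, h2⟩ | ⟨⟨h1, -⟩, h2⟩
        · obtain ⟨k, hk, hpk⟩ := (hUmem _ _).mp h2
          exact ⟨h1, k, by omega, hpk⟩
        · obtain ⟨k, hk, hpk⟩ := (hRmem _ _ _).mp h2
          exact ⟨h1, j + k, by omega, hpk⟩
      have h' := Finset.card_le_card hsub
      rw [Finset.card_union_of_disjoint ((hUR j i).mono Finset.inter_subset_right
        Finset.inter_subset_right)] at h'
      omega
    have hSd : S = (S ∩ U j) ∪ (S ∩ R j (n - j)) := by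
      rw [← Finset.inter_union_distrib_left, ← hURn j hjn, Finset.inter_eq_left.mpr hS]
    have hdis : Disjoint (S ∩ U j) (S ∩ R j (n - j)) :=
      (hUR j (n - j)).mono Finset.inter_subset_right Finset.inter_subset_right
    have hg := hG j hjn (S ∩ U j) Finset.inter_subset_right (S ∩ R j (n - j))
      Finset.inter_subset_right
    simp only [hF, hH]
    rw [if_pos c1, if_pos c2]
    calc G S * ∏ p ∈ S, w p = G ((S ∩ U j) ∪ (S ∩ R j (n - j))) *
          ((∏ p ∈ S ∩ U j, w p) * ∏ p ∈ S ∩ R j (n - j), w p) := by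
          rw [← Finset.prod_union hdis, ← hSd]
      _ ≤ (2 ^ (S ∩ R j (n - j)).card * (1 + ∑ p ∈ S ∩ U j, ℓ p)) *
          ((∏ p ∈ S ∩ U j, w p) * ∏ p ∈ S ∩ R j (n - j), w p) :=
          mul_le_mul_of_nonneg_right hg (mul_nonneg (hprod _) (hprod _))
      _ = _ := by ring
  have hsumF : ∀ j, ∑ A ∈ (U j).powerset, F j A ≤
      (1 + K) * C₂ * (2 * Real.log 2 * Real.exp 1) ^ j * ballotDecay j := by
    intro j
    have hVP : Pairwise (Function.onFun Disjoint
        fun i => if i < j then P (j - 1 - i) else ∅) := by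
      intro a b hab
      simp only [Function.onFun]
      split_ifs
      · exact hP (show j - 1 - a ≠ j - 1 - b by omega)
      all_goals simp
    have hVs : ∀ i, ∑ p ∈ (if i < j then P (j - 1 - i) else ∅), w p ≤ Real.log 2 := by
      intro i
      split_ifs
      · exact hsum _
      · simpa using hlog.le
    have hℓw : ∑ p ∈ U j, ℓ p * w p ≤ K * 2 ^ j := by
      rw [hU, Finset.sum_biUnion fun a _ b _ hab => hP hab]
      calc _ ≤ ∑ i ∈ range j, K * 2 ^ i := by
            refine Finset.sum_le_sum fun i _ => ?_
            calc _ ≤ ∑ p ∈ P i, K * 2 ^ i * w p :=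
                  Finset.sum_le_sum fun p hp => mul_le_mul_of_nonneg_right (hℓK i p hp) (hw p)
              _ = K * 2 ^ i * ∑ p ∈ P i, w p := by rw [Finset.mul_sum]
              _ ≤ K * 2 ^ i * 1 := mul_le_mul_of_nonneg_left ((hsum i).trans hlog1)
                  (by positivity)
              _ = _ := mul_one _
        _ = K * (2 ^ j - 1) := by
            rw [← Finset.mul_sum, geom_sum_eq (by norm_num)]
            norm_num
        _ ≤ _ := by gcongr; linarith
    have h4 := h₂ hVP hw hVs j
    have h5 := sum_one_add_sum_mul_prod_le (V j j) hw hℓ (V j) j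
    rw [hVU] at h5
    rw [show (range j).biUnion (fun i => if i < j then P (j - 1 - i) else ∅) = U j from
      hVU j] at h4
    have hb := ballotDecay_pos j
    have hX : (1 : ℝ) ≤ 2 ^ j := one_le_pow₀ one_le_two
    calc _ ≤ _ := by rw [hF, ← Finset.sum_filter]
      _ ≤ (1 + K * 2 ^ j) * (C₂ * (Real.log 2 * Real.exp 1) ^ j * ballotDecay j) := by
          refine h5.trans (mul_le_mul (by linarith) ?_ (Finset.sum_nonneg fun S _ => hprod S)
            (by positivity))
          exact h4
      _ ≤ ((1 + K) * 2 ^ j) * (C₂ * (Real.log 2 * Real.exp 1) ^ j * ballotDecay j) := by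
          gcongr
          linarith
      _ = _ := by rw [mul_assoc 2, mul_pow 2]; ring
  have hsumH : ∀ j ≤ n, ∑ B ∈ (R j (n - j)).powerset, H j B ≤
      C₁ * (2 * Real.log 2 * Real.exp 1) ^ (n - j) * ballotDecay (n - j) := by
    intro j hj
    have hRP : Pairwise (Function.onFun Disjoint fun i => P (j + i)) := by
      intro a b hab
      exact hP (show j + a ≠ j + b by omega)
    have h4 := h₁ hRP hw (fun i => hsum _) (n - j)
    rw [hH, ← Finset.sum_filter]
    exact h4
  calc _ ≤ ∑ S ∈ (U n).powerset, ∑ j ∈ range (n + 1),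
        F j (S ∩ U j) * H j (S ∩ R j (n - j)) := Finset.sum_le_sum hsel
    _ = ∑ j ∈ range (n + 1), ∑ S ∈ (U n).powerset,
        F j (S ∩ U j) * H j (S ∩ R j (n - j)) := Finset.sum_comm
    _ = ∑ j ∈ range (n + 1), (∑ A ∈ (U j).powerset, F j A) *
        ∑ B ∈ (R j (n - j)).powerset, H j B := by
        refine Finset.sum_congr rfl fun j hj => ?_
        have hjn : j ≤ n := by rw [Finset.mem_range] at hj; omega
        rw [hURn j hjn, sum_powerset_union (hUR _ _), Finset.sum_mul_sum]
        refine Finset.sum_congr rfl fun A hA => Finset.sum_congr rfl fun B hB => ?_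
        rw [Finset.mem_powerset] at hA hB
        have e1 : B ∩ U j = ∅ := Finset.disjoint_iff_inter_eq_empty.mp
          ((hUR j (n - j)).mono_right hB).symm
        have e2 : A ∩ R j (n - j) = ∅ := Finset.disjoint_iff_inter_eq_empty.mp
          ((hUR j (n - j)).mono_left hA)
        rw [Finset.union_inter_distrib_right, Finset.union_inter_distrib_right, e1, e2,
          Finset.union_empty, Finset.empty_union, Finset.inter_eq_left.mpr hA,
          Finset.inter_eq_left.mpr hB]
    _ ≤ ∑ j ∈ range (n + 1), C₁ * C₂ * (1 + K) * (2 * Real.log 2 * Real.exp 1) ^ n *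
        (ballotDecay j * ballotDecay (n - j)) := by
        refine Finset.sum_le_sum fun j hj => ?_
        have hjn : j ≤ n := by rw [Finset.mem_range] at hj; omega
        have hb := ballotDecay_pos j
        refine (mul_le_mul (hsumF j) (hsumH j hjn) (Finset.sum_nonneg fun B _ => hH0 _ _)
          (by positivity)).trans (le_of_eq ?_)
        nth_rewrite 3 [show n = j + (n - j) by omega]
        rw [pow_add]
        ring
    _ ≤ _ := by
        rw [← Finset.mul_sum]
        refine (mul_le_mul_of_nonneg_left (h₃ n) (by positivity)).trans (le_of_eq ?_)
        ring

end

section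
open Finset

lemma card_divisors_le_two_mul_sqrt (n : ℕ) : n.divisors.card ≤ 2 * n.sqrt := by
  have hsub : n.divisors ⊆ Icc 1 n.sqrt ∪ (Icc 1 n.sqrt).image (n / ·) := by
    intro d hd
    obtain ⟨⟨e, rfl⟩, hn⟩ := Nat.mem_divisors.mp hd
    have hd0 : 0 < d := Nat.pos_of_ne_zero (left_ne_zero_of_mul hn)
    have he0 : 0 < e := Nat.pos_of_ne_zero (right_ne_zero_of_mul hn)
    rw [Finset.mem_union, Finset.mem_Icc, Finset.mem_image]
    rcases le_total d e with h | h
    · exact Or.inl ⟨hd0, Nat.le_sqrt.mpr (Nat.mul_le_mul_left d h)⟩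
    · exact Or.inr ⟨e, Finset.mem_Icc.mpr ⟨he0, Nat.le_sqrt.mpr (Nat.mul_le_mul_right e h)⟩,
        Nat.mul_div_cancel d he0⟩
  calc _ ≤ _ := Finset.card_le_card hsub
    _ ≤ _ := Finset.card_union_le _ _
    _ ≤ n.sqrt + n.sqrt := by
        refine add_le_add (by simp) (Finset.card_image_le.trans (by simp))
    _ = _ := (two_mul _).symm

lemma card_divisors_mul_le (m n : ℕ) :
    (m * n).divisors.card ≤ m.divisors.card * n.divisors.card := by
  rw [Nat.divisors_mul]
  exact Finset.card_mul_le

lemma card_divisors_prod_le {S : Finset ℕ} (hS : ∀ p ∈ S, p.Prime) :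
    (∏ p ∈ S, p).divisors.card ≤ 2 ^ S.card := by
  induction S using Finset.induction_on with
  | empty => simp
  | insert p S hp ih =>
    rw [Finset.prod_insert hp, Finset.card_insert_of_notMem hp, pow_succ']
    refine (card_divisors_mul_le _ _).trans (Nat.mul_le_mul (le_of_eq ?_)
      (ih fun q hq => hS q (Finset.mem_insert_of_mem hq)))
    have hpp := hS p (Finset.mem_insert_self _ _)
    rw [hpp.divisors, Finset.card_pair hpp.one_lt.ne]

lemma sum_sum_divisorsAntidiagonal_le (n : ℕ) {f : ℕ × ℕ → ℝ} (hf : ∀ x, 0 ≤ f x) :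
    ∑ d ∈ Ioc 0 n, ∑ x ∈ d.divisorsAntidiagonal, f x ≤ ∑ x ∈ Ioc 0 n ×ˢ Ioc 0 n, f x := by
  rw [← Finset.sum_biUnion]
  · refine Finset.sum_le_sum_of_subset_of_nonneg ?_ fun x _ _ => hf x
    intro x hx
    obtain ⟨d, hd, hx⟩ := Finset.mem_biUnion.mp hx
    rw [Finset.mem_Ioc] at hd
    rw [Nat.mem_divisorsAntidiagonal] at hx
    obtain ⟨rfl, hx0⟩ := hx
    have h1 : 0 < x.1 := Nat.pos_of_ne_zero (left_ne_zero_of_mul hx0)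
    have h2 : 0 < x.2 := Nat.pos_of_ne_zero (right_ne_zero_of_mul hx0)
    rw [Finset.mem_product, Finset.mem_Ioc, Finset.mem_Ioc]
    exact ⟨⟨h1, (Nat.le_mul_of_pos_right _ h2).trans hd.2⟩,
      h2, (Nat.le_mul_of_pos_left _ h1).trans hd.2⟩
  · intro a _ b _ hab
    rw [Function.onFun, Finset.disjoint_left]
    intro x hx hx'
    rw [Nat.mem_divisorsAntidiagonal] at hx hx'
    exact hab (hx.1.symm.trans hx'.1)

lemma exists_sum_card_divisors_sq_div_sq_le : ∃ C > 0, ∀ n : ℕ,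
    ∑ m ∈ Ioc 0 n, ((m ^ 2).divisors.card : ℝ) / (m : ℝ) ^ 2 ≤ C := by
  have hpos : 0 < ∑' j, ballotDecay j :=
    summable_ballotDecay.tsum_pos (fun j => (ballotDecay_pos j).le) 0 (ballotDecay_pos 0)
  refine ⟨2 * (∑' j, ballotDecay j) ^ 2, by positivity, fun n => ?_⟩
  set g : ℕ → ℝ := fun k => 1 / (k * √k) with hg
  have hg0 : ∀ k, 0 ≤ g k := fun k => by simp only [hg]; positivity
  have hgs : ∑ k ∈ Ioc 0 n, g k ≤ ∑' j, ballotDecay j := by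
    refine le_trans (le_of_eq ?_)
      (summable_ballotDecay.sum_le_tsum (range n) fun j _ => (ballotDecay_pos j).le)
    rw [← Finset.Ico_add_one_add_one_eq_Ioc, Finset.sum_Ico_eq_sum_range]
    simp only [zero_add, Nat.add_sub_cancel, hg, ballotDecay]
    refine Finset.sum_congr rfl fun k _ => ?_
    push_cast
    rw [add_comm (1 : ℝ)]
  calc _ ≤ ∑ m ∈ Ioc 0 n, ∑ x ∈ m.divisorsAntidiagonal, 2 * (g x.1 * g x.2) := by
        refine Finset.sum_le_sum fun m hm => ?_
        have hm0 : (0 : ℝ) < m := by exact_mod_cast (Finset.mem_Ioc.mp hm).1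
        have e : ∑ x ∈ m.divisorsAntidiagonal, 2 * (g x.1 * g x.2) =
            m.divisors.card * (2 * g m) := by
          rw [Nat.sum_divisorsAntidiagonal fun a b => 2 * (g a * g b), ← nsmul_eq_mul,
            ← Finset.sum_const]
          refine Finset.sum_congr rfl fun d hd => ?_
          have hd' := Nat.dvd_of_mem_divisors hd
          have hdm : (m : ℝ) = d * ((m / d : ℕ) : ℝ) := by
            exact_mod_cast (Nat.mul_div_cancel' hd').symm
          simp only [hg]
          rw [hdm, Real.sqrt_mul (by positivity)]
          simp only [one_div, mul_inv]
          ring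
        rw [e]
        have h1 : ((m ^ 2).divisors.card : ℝ) ≤ m.divisors.card * (2 * √m) := by
          rw [sq]
          refine (Nat.cast_le.mpr (card_divisors_mul_le m m)).trans ?_
          push_cast
          refine mul_le_mul_of_nonneg_left ?_ (by positivity)
          refine (Nat.cast_le.mpr (card_divisors_le_two_mul_sqrt m)).trans ?_
          push_cast
          exact mul_le_mul_of_nonneg_left Real.nat_sqrt_le_real_sqrt zero_le_two
        calc _ ≤ m.divisors.card * (2 * √m) / (m : ℝ) ^ 2 := by gcongr
          _ = _ := by
            simp only [hg]
            have hs := Real.sqrt_pos.mpr hm0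
            have hs2 := Real.sq_sqrt hm0.le
            field_simp
            rw [hs2]
    _ ≤ ∑ x ∈ Ioc 0 n ×ˢ Ioc 0 n, 2 * (g x.1 * g x.2) :=
        sum_sum_divisorsAntidiagonal_le n (f := fun x => 2 * (g x.1 * g x.2)) fun x =>
          mul_nonneg zero_le_two (mul_nonneg (hg0 _) (hg0 _))
    _ = 2 * (∑ k ∈ Ioc 0 n, g k) ^ 2 := by
        rw [← Finset.mul_sum, Finset.sum_product, sq, Finset.sum_mul_sum]
    _ ≤ _ := by
        have : 0 ≤ ∑ k ∈ Ioc 0 n, g k := Finset.sum_nonneg fun k _ => hg0 k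
        gcongr

/-- The largest ratio `min (u / v) (v / u)` over the factorizations `u * v = d`. -/
noncomputable def divisorCloseness (d : ℕ) : ℝ :=
  ⨆ x : d.divisorsAntidiagonal, Real.exp (-|Real.log x.1.1 - Real.log x.1.2|)

lemma exp_le_divisorCloseness {u v d : ℕ} (h : u * v = d) (hd : d ≠ 0) :
    Real.exp (-|Real.log u - Real.log v|) ≤ divisorCloseness d :=
  le_ciSup (f := fun x : d.divisorsAntidiagonal =>
      Real.exp (-|Real.log x.1.1 - Real.log x.1.2|))
    (Set.finite_range _).bddAbove
    ⟨(u, v), Nat.mem_divisorsAntidiagonal.mpr ⟨h, hd⟩⟩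

lemma divisorCloseness_nonneg (d : ℕ) : 0 ≤ divisorCloseness d :=
  Real.iSup_nonneg fun _ => (Real.exp_pos _).le

lemma divisorCloseness_le_one (d : ℕ) : divisorCloseness d ≤ 1 :=
  Real.iSup_le (fun _ => Real.exp_le_one_iff.mpr (neg_nonpos.mpr (abs_nonneg _))) zero_le_one

lemma divisorCloseness_mul_prime_le {a b p : ℕ} (ha : 0 < a) (hb : 0 < b) (hp : p.Prime) :
    divisorCloseness (a * b * p) ≤ ∑ y ∈ b.divisorsAntidiagonal,
      Real.exp (-max 0 (|Real.log p - (Real.log y.2 - Real.log y.1)| - Real.log a)) := by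
  have key : ∀ u v : ℕ, u * v = a * b →
      Real.exp (-|Real.log p + Real.log u - Real.log v|) ≤ ∑ y ∈ b.divisorsAntidiagonal,
        Real.exp (-max 0 (|Real.log p - (Real.log y.2 - Real.log y.1)| - Real.log a)) := by
    intro u v huv
    obtain ⟨u₁, u₂, ⟨v₁, hv₁⟩, ⟨v₂, hv₂⟩, hu⟩ :=
      exists_dvd_and_dvd_of_dvd_mul (Dvd.intro v huv)
    have hu₁ : 0 < u₁ := Nat.pos_of_ne_zero (by rintro rfl; simp at hv₁; omega)
    have hu₂ : 0 < u₂ := Nat.pos_of_ne_zero (by rintro rfl; simp at hv₂; omega)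
    have hw₁ : 0 < v₁ := Nat.pos_of_ne_zero (by rintro rfl; simp at hv₁; omega)
    have hw₂ : 0 < v₂ := Nat.pos_of_ne_zero (by rintro rfl; simp at hv₂; omega)
    have hv : v = v₁ * v₂ := by
      refine Nat.eq_of_mul_eq_mul_left (Nat.mul_pos hu₁ hu₂) ?_
      rw [← hu, huv, hv₁, hv₂, hu]
      ring
    refine le_trans ?_ (Finset.single_le_sum (f := fun y : ℕ × ℕ =>
      Real.exp (-max 0 (|Real.log p - (Real.log y.2 - Real.log y.1)| - Real.log a)))
      (fun y _ => (Real.exp_pos _).le)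
      (Nat.mem_divisorsAntidiagonal.mpr ⟨hv₂.symm, hb.ne'⟩ : (u₂, v₂) ∈ _))
    refine Real.exp_le_exp.mpr (neg_le_neg (max_le (abs_nonneg _) ?_))
    have e1 : Real.log u = Real.log u₁ + Real.log u₂ := by
      rw [hu, Nat.cast_mul, Real.log_mul (by positivity) (by positivity)]
    have e2 : Real.log v = Real.log v₁ + Real.log v₂ := by
      rw [hv, Nat.cast_mul, Real.log_mul (by positivity) (by positivity)]
    have e3 : Real.log a = Real.log u₁ + Real.log v₁ := by
      rw [hv₁, Nat.cast_mul, Real.log_mul (by positivity) (by positivity)]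
    have l1 := Real.log_natCast_nonneg u₁
    have l2 := Real.log_natCast_nonneg v₁
    have h := abs_sub_le (Real.log p - (Real.log v₂ - Real.log u₂))
      (Real.log p + Real.log u - Real.log v) 0
    have h' : |Real.log p - (Real.log v₂ - Real.log u₂) -
        (Real.log p + Real.log u - Real.log v)| ≤ Real.log a := by
      rw [abs_le]; constructor <;> linarith
    rw [sub_zero, sub_zero] at h
    simp only
    linarith
  refine Real.iSup_le ?_ (Finset.sum_nonneg fun y _ => (Real.exp_pos _).le)
  rintro ⟨⟨u, v⟩, hx⟩
  obtain ⟨huv, h0⟩ := Nat.mem_divisorsAntidiagonal.mp hx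
  simp only at huv ⊢
  have hp0 : (p : ℝ) ≠ 0 := by exact_mod_cast hp.pos.ne'
  have hu0 : u ≠ 0 := by rintro rfl; rw [zero_mul] at huv; exact h0 huv.symm
  have hv0 : v ≠ 0 := by rintro rfl; rw [mul_zero] at huv; exact h0 huv.symm
  rcases (Nat.Prime.dvd_mul hp).mp (Dvd.intro_left (a * b) huv.symm) with ⟨w, rfl⟩ | ⟨w, rfl⟩
  · have hw0 : (w : ℝ) ≠ 0 := by exact_mod_cast right_ne_zero_of_mul hu0
    rw [Nat.cast_mul, Real.log_mul hp0 hw0]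
    refine key w v (Nat.eq_of_mul_eq_mul_left hp.pos ?_)
    linarith
  · have hw0 : (w : ℝ) ≠ 0 := by exact_mod_cast right_ne_zero_of_mul hv0
    rw [Nat.cast_mul, Real.log_mul hp0 hw0, abs_sub_comm]
    refine key w u (Nat.eq_of_mul_eq_mul_left hp.pos ?_)
    linarith

lemma exists_sum_log_div_mul_divisorCloseness_le : ∃ C > 0, ∀ n a b : ℕ, 0 < a → 0 < b →
    ∑ p ∈ Ioc 0 n with p.Prime, Real.log p / p * divisorCloseness (a * b * p) ≤
      C * b.divisors.card * (1 + Real.log a) := by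
  obtain ⟨C, hC, h⟩ := exists_sum_log_div_mul_exp_le
  refine ⟨C + 1, by positivity, fun n a b ha hb => ?_⟩
  have hla := Real.log_natCast_nonneg a
  calc _ ≤ ∑ p ∈ Ioc 0 n with p.Prime, ∑ y ∈ b.divisorsAntidiagonal, Real.log p / p *
          Real.exp (-max 0 (|Real.log p - (Real.log y.2 - Real.log y.1)| - Real.log a)) := by
        refine Finset.sum_le_sum fun p hp => ?_
        rw [← Finset.mul_sum]
        exact mul_le_mul_of_nonneg_left
          (divisorCloseness_mul_prime_le ha hb (Finset.mem_filter.mp hp).2)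
          (div_nonneg (Real.log_natCast_nonneg p) (Nat.cast_nonneg p))
    _ ≤ ∑ y ∈ b.divisorsAntidiagonal, C * (1 + Real.log a) := by
        rw [Finset.sum_comm]
        exact Finset.sum_le_sum fun y _ => h n _ _ hla
    _ = C * b.divisors.card * (1 + Real.log a) := by
        rw [Finset.sum_const, ← Nat.map_div_right_divisors, Finset.card_map, nsmul_eq_mul]
        ring
    _ ≤ _ := by gcongr; linarith

/-- The sum of the reciprocals of the primes up to `n`. -/
noncomputable def primeInvSum (n : ℕ) : ℝ := ∑ p ∈ Ioc 0 n with p.Prime, 1 / (p : ℝ)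

/-- The index `j` of the block `log 2 * j < ∑ 1 / q ≤ log 2 * (j + 1)` containing the prime `p`,
where the sum is over the primes `q ≤ p`. -/
noncomputable def primeBlock (p : ℕ) : ℕ := ⌈primeInvSum p / Real.log 2⌉₊ - 1

/-- A prime is a block leader if it is the smallest prime of its block. -/
def IsBlockLeader (p : ℕ) : Prop := p.Prime ∧ ∀ q < p, q.Prime → primeBlock q ≠ primeBlock p

lemma primeInvSum_pos {p : ℕ} (hp : p.Prime) : 0 < primeInvSum p := by
  have hp0 : (0 : ℝ) < p := by exact_mod_cast hp.pos
  refine lt_of_lt_of_le (one_div_pos.mpr hp0)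
    (Finset.single_le_sum (f := fun q : ℕ => 1 / (q : ℝ)) (fun q _ => by positivity) ?_)
  rw [Finset.mem_filter, Finset.mem_Ioc]
  exact ⟨⟨hp.pos, le_rfl⟩, hp⟩

lemma primeInvSum_add_sum_Ioc {m n : ℕ} (h : m ≤ n) :
    primeInvSum m + ∑ p ∈ Ioc m n with p.Prime, 1 / (p : ℝ) = primeInvSum n := by
  simp only [primeInvSum, Finset.sum_filter]
  exact Finset.sum_Ioc_consecutive _ (Nat.zero_le m) h

lemma primeBlock_lt {p : ℕ} (hp : p.Prime) : Real.log 2 * primeBlock p < primeInvSum p := by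
  have hlog := Real.log_pos one_lt_two
  have h0 : 0 < primeInvSum p / Real.log 2 := div_pos (primeInvSum_pos hp) hlog
  have h1 : 0 < ⌈primeInvSum p / Real.log 2⌉₊ := Nat.ceil_pos.mpr h0
  have h2 := Nat.ceil_lt_add_one h0.le
  rw [mul_comm, ← lt_div_iff₀ hlog, primeBlock, Nat.cast_pred h1]
  linarith

lemma primeInvSum_le_primeBlock {p : ℕ} (hp : p.Prime) :
    primeInvSum p ≤ Real.log 2 * (primeBlock p + 1) := by
  have hlog := Real.log_pos one_lt_two
  have h0 : 0 < primeInvSum p / Real.log 2 := div_pos (primeInvSum_pos hp) hlog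
  have h1 : 0 < ⌈primeInvSum p / Real.log 2⌉₊ := Nat.ceil_pos.mpr h0
  rw [mul_comm, ← div_le_iff₀ hlog, primeBlock, Nat.cast_pred h1, sub_add_cancel]
  exact Nat.le_ceil _

open Classical in
lemma sum_primeBlock_le (n j : ℕ) :
    ∑ p ∈ Ioc 0 n with p.Prime ∧ ¬ IsBlockLeader p ∧ primeBlock p = j, 1 / (p : ℝ) ≤
      Real.log 2 := by
  set A := (Ioc 0 n).filter fun p => p.Prime ∧ ¬ IsBlockLeader p ∧ primeBlock p = j with hA
  rcases A.eq_empty_or_nonempty with h | h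
  · rw [h, Finset.sum_empty]
    exact (Real.log_pos one_lt_two).le
  have hM := Finset.max'_mem A h
  set M := A.max' h with hMdef
  obtain ⟨-, hMp, -, hMj⟩ := Finset.mem_filter.mp hM
  have hex : ∃ q, q.Prime ∧ primeBlock q = j := ⟨M, hMp, hMj⟩
  obtain ⟨hfp, hfj⟩ := Nat.find_spec hex
  set f := Nat.find hex with hf
  have hlead : IsBlockLeader f := by
    refine ⟨hfp, fun q hq hqp he => ?_⟩
    exact Nat.find_min hex hq ⟨hqp, he.trans hfj⟩
  have hfM : f ≤ M := Nat.find_min' hex ⟨hMp, hMj⟩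
  have hsub : A ⊆ (Ioc f M).filter Nat.Prime := by
    intro p hp
    have hpM := Finset.le_max' A p hp
    obtain ⟨-, hpp, hpl, hpj⟩ := Finset.mem_filter.mp hp
    have h1 : f ≤ p := Nat.find_min' hex ⟨hpp, hpj⟩
    have h2 : f ≠ p := by intro h; rw [← h] at hpl; exact hpl hlead
    rw [Finset.mem_filter, Finset.mem_Ioc]
    exact ⟨⟨by omega, hpM⟩, hpp⟩
  refine (Finset.sum_le_sum_of_subset_of_nonneg hsub fun p _ _ => by positivity).trans ?_
  have h1 := primeInvSum_add_sum_Ioc hfM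
  have h2 := primeBlock_lt hfp
  have h3 := primeInvSum_le_primeBlock hMp
  rw [hfj] at h2
  rw [hMj] at h3
  linarith

lemma exists_log_le_mul_two_pow_primeBlock : ∃ K ≥ 0, ∀ p : ℕ, p.Prime →
    Real.log p ≤ K * 2 ^ primeBlock p := by
  obtain ⟨C, hC, h⟩ := exists_abs_sum_prime_inv_sub_log_log_le
  refine ⟨2 * Real.exp C, by positivity, fun p hp => ?_⟩
  have h1 := (abs_le.mp (h p hp.two_le)).1
  have h2 := primeInvSum_le_primeBlock hp
  rw [primeInvSum] at h2
  have hl : 0 < Real.log p := Real.log_pos (by exact_mod_cast hp.one_lt)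
  calc Real.log p = Real.exp (Real.log (Real.log p)) := (Real.exp_log hl).symm
    _ ≤ Real.exp (C + Real.log 2 * ((primeBlock p + 1 : ℕ) : ℝ)) := by
        refine Real.exp_le_exp.mpr ?_
        push_cast
        linarith
    _ = _ := by
        rw [Real.exp_add, mul_comm (Real.log 2), Real.exp_nat_mul, Real.exp_log two_pos, pow_succ]
        ring

open Classical in
lemma exists_sum_isBlockLeader_le : ∃ C ≥ 0, ∀ n : ℕ,
    ∑ p ∈ Ioc 0 n with IsBlockLeader p, 1 / (p : ℝ) ≤ C := by
  obtain ⟨C, hC, h⟩ := exists_abs_sum_prime_inv_sub_log_log_le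
  have hc : 0 < Real.exp (-C) := Real.exp_pos _
  have hs : Summable fun j : ℕ => Real.exp (j * -Real.exp (-C)) :=
    Real.summable_exp_nat_mul_iff.mpr (by linarith)
  refine ⟨∑' j : ℕ, Real.exp (j * -Real.exp (-C)), tsum_nonneg fun j => (Real.exp_pos _).le,
    fun n => ?_⟩
  have hinj : Set.InjOn primeBlock ((Ioc 0 n).filter IsBlockLeader : Set ℕ) := by
    intro p hp q hq hpq
    obtain ⟨-, hp⟩ := Finset.mem_filter.mp hp
    obtain ⟨-, hq⟩ := Finset.mem_filter.mp hq
    rcases lt_trichotomy p q with hlt | rfl | hlt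
    · exact absurd hpq (hq.2 p hlt hp.1)
    · rfl
    · exact absurd hpq.symm (hp.2 q hlt hq.1)
  calc _ ≤ ∑ p ∈ Ioc 0 n with IsBlockLeader p, Real.exp (primeBlock p * -Real.exp (-C)) := by
        refine Finset.sum_le_sum fun p hp => ?_
        obtain ⟨-, hp⟩ := Finset.mem_filter.mp hp
        have hp0 : (0 : ℝ) < p := by exact_mod_cast hp.1.pos
        have hl : 0 < Real.log p := Real.log_pos (by exact_mod_cast hp.1.one_lt)
        have h1 := (abs_le.mp (h p hp.1.two_le)).2
        have h2 := primeBlock_lt hp.1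
        rw [primeInvSum] at h2
        have h3 : (primeBlock p : ℝ) * Real.exp (-C) ≤ Real.log p := by
          calc (primeBlock p : ℝ) * Real.exp (-C) ≤ 2 ^ primeBlock p * Real.exp (-C) := by
                gcongr
                exact_mod_cast Nat.lt_two_pow_self.le
            _ = Real.exp (primeBlock p * Real.log 2 + -C) := by
                rw [Real.exp_add, Real.exp_nat_mul, Real.exp_log two_pos]
            _ ≤ Real.exp (Real.log (Real.log p)) := Real.exp_le_exp.mpr (by linarith)
            _ = _ := Real.exp_log hl
        rw [mul_neg, Real.exp_neg, one_div]
        refine inv_anti₀ (Real.exp_pos _) ?_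
        rwa [← Real.le_log_iff_exp_le hp0]
    _ = ∑ j ∈ ((Ioc 0 n).filter IsBlockLeader).image primeBlock,
          Real.exp (j * -Real.exp (-C)) := by rw [Finset.sum_image hinj]
    _ ≤ _ := hs.sum_le_tsum _ fun j _ => (Real.exp_pos _).le

lemma sum_Ioc_le_sum_powerset_sum_powerset {n : ℕ} {U E : Finset ℕ}
    (h : ∀ p ∈ Ioc 0 n, p.Prime → p ∈ U ∨ p ∈ E) {f : ℕ → ℝ} (hf : ∀ a, 0 ≤ f a) :
    ∑ a ∈ Ioc 0 n, f a ≤ ∑ T ∈ E.powerset, ∑ m ∈ Ioc 0 n, ∑ S ∈ U.powerset,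
      f ((∏ p ∈ S, p) * ((∏ p ∈ T, p) * m ^ 2)) := by
  rw [← Finset.sum_product', ← Finset.sum_product']
  refine le_trans ?_ (Finset.sum_image_le_of_nonneg
    (g := fun x : (Finset ℕ × ℕ) × Finset ℕ => (∏ p ∈ x.2, p) * ((∏ p ∈ x.1.1, p) * x.1.2 ^ 2))
    (f := f) fun a _ => hf a)
  refine Finset.sum_le_sum_of_subset_of_nonneg ?_ fun a _ _ => hf a
  intro a ha
  obtain ⟨ha0, han⟩ := Finset.mem_Ioc.mp ha
  obtain ⟨s, m, hms, hs⟩ := Nat.sq_mul_squarefree a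
  have hm0 : 0 < m := by
    rcases Nat.eq_zero_or_pos m with rfl | h0
    · simp at hms; omega
    · exact h0
  have hs0 : 0 < s := Nat.pos_of_ne_zero hs.ne_zero
  have hmn : m ≤ n := by nlinarith
  have hsn : s ≤ n := by nlinarith [Nat.pow_pos (n := 2) hm0]
  have hmem : ∀ p ∈ s.primeFactors, p ∈ U ∨ p ∈ E := fun p hp =>
    h p (Finset.mem_Ioc.mpr ⟨(Nat.prime_of_mem_primeFactors hp).pos,
      (Nat.le_of_mem_primeFactors hp).trans hsn⟩) (Nat.prime_of_mem_primeFactors hp)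
  refine Finset.mem_image.mpr ⟨((s.primeFactors.filter (· ∉ U), m), s.primeFactors.filter (· ∈ U)),
    ?_, ?_⟩
  · simp only [Finset.mem_product, Finset.mem_powerset, Finset.mem_Ioc]
    refine ⟨⟨fun p hp => ?_, hm0, hmn⟩, fun p hp => (Finset.mem_filter.mp hp).2⟩
    obtain ⟨h1, h2⟩ := Finset.mem_filter.mp hp
    exact (hmem p h1).resolve_left h2
  · have := Finset.prod_filter_mul_prod_filter_not s.primeFactors (· ∈ U) fun p => p
    simp only
    rw [← mul_assoc, this, Nat.prod_primeFactors_of_squarefree hs, mul_comm, hms]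

open Classical in
lemma exists_sum_card_divisors_div_le : ∃ C > 0, ∀ n : ℕ,
    ∑ T ∈ ((Ioc 0 n).filter IsBlockLeader).powerset, ∑ m ∈ Ioc 0 n,
      ((((∏ p ∈ T, p) * m ^ 2).divisors.card : ℝ) / ((((∏ p ∈ T, p) * m ^ 2 : ℕ)) : ℝ)) ≤ C := by
  obtain ⟨C₁, hC₁, h₁⟩ := exists_sum_card_divisors_sq_div_sq_le
  obtain ⟨C₂, hC₂, h₂⟩ := exists_sum_isBlockLeader_le
  refine ⟨Real.exp (2 * C₂) * C₁, by positivity, fun n => ?_⟩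
  set E := (Ioc 0 n).filter IsBlockLeader with hE
  calc _ ≤ ∑ T ∈ E.powerset, ∑ m ∈ Ioc 0 n, (∏ p ∈ T, (2 * (1 / (p : ℝ)))) *
        (((m ^ 2).divisors.card : ℝ) / (m : ℝ) ^ 2) := by
        refine Finset.sum_le_sum fun T hT => Finset.sum_le_sum fun m hm => ?_
        have hTp : ∀ p ∈ T, p.Prime := fun p hp =>
          (Finset.mem_filter.mp (Finset.mem_powerset.mp hT hp)).2.1
        have hd : (((∏ p ∈ T, p) * m ^ 2).divisors.card : ℝ) ≤
            2 ^ T.card * ((m ^ 2).divisors.card : ℝ) := by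
          exact_mod_cast (card_divisors_mul_le _ _).trans
            (Nat.mul_le_mul_right _ (card_divisors_prod_le hTp))
        have hprod : ∏ p ∈ T, (2 * (1 / (p : ℝ))) = 2 ^ T.card / ∏ p ∈ T, (p : ℝ) := by
          rw [Finset.prod_mul_distrib, Finset.prod_const, Finset.prod_div_distrib,
            Finset.prod_const_one, mul_one_div]
        rw [hprod, div_mul_div_comm]
        push_cast
        gcongr
    _ = (∏ p ∈ E, (1 + 2 * (1 / (p : ℝ)))) *
        ∑ m ∈ Ioc 0 n, ((m ^ 2).divisors.card : ℝ) / (m : ℝ) ^ 2 := by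
        rw [Finset.prod_one_add, Finset.sum_mul_sum]
    _ ≤ _ := by
        refine mul_le_mul ?_ (h₁ n) (Finset.sum_nonneg fun m _ => by positivity) (Real.exp_pos _).le
        refine (Real.prod_one_add_le_exp_sum _ fun p => by positivity).trans ?_
        rw [← Finset.mul_sum]
        exact Real.exp_le_exp.mpr (mul_le_mul_of_nonneg_left (h₂ n) two_pos.le)

/-- The sum of `log p / p` over the primes `p ≤ n`, weighted by the closeness of `a * p`. -/
noncomputable def primeCloseness (n a : ℕ) : ℝ :=
  ∑ p ∈ Ioc 0 n with p.Prime, Real.log p / p * divisorCloseness (a * p)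

lemma primeCloseness_nonneg (n a : ℕ) : 0 ≤ primeCloseness n a := by
  refine Finset.sum_nonneg fun p _ => mul_nonneg ?_ (divisorCloseness_nonneg _)
  exact div_nonneg (Real.log_natCast_nonneg p) (Nat.cast_nonneg p)

lemma exists_primeCloseness_le : ∃ C > 0, ∀ (n : ℕ) {A B : Finset ℕ} {e : ℕ}, Disjoint A B →
    (∀ p ∈ A ∪ B, p.Prime) → 0 < e →
    primeCloseness n ((∏ p ∈ A ∪ B, p) * e) ≤
      C * e.divisors.card * (2 ^ B.card * (1 + ∑ p ∈ A, Real.log p)) := by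
  obtain ⟨C, hC, h⟩ := exists_sum_log_div_mul_divisorCloseness_le
  refine ⟨C, hC, fun n A B e hAB hp he => ?_⟩
  have hA : ∀ p ∈ A, p.Prime := fun p hpA => hp p (Finset.mem_union_left _ hpA)
  have hB : ∀ p ∈ B, p.Prime := fun p hpB => hp p (Finset.mem_union_right _ hpB)
  have h1 := h n (∏ p ∈ A, p) ((∏ p ∈ B, p) * e) (Finset.prod_pos fun p hpA => (hA p hpA).pos)
    (Nat.mul_pos (Finset.prod_pos fun p hpB => (hB p hpB).pos) he)
  rw [← mul_assoc, ← Finset.prod_union hAB] at h1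
  refine h1.trans ?_
  have hlog : Real.log ((∏ p ∈ A, p : ℕ) : ℝ) = ∑ p ∈ A, Real.log p := by
    rw [Nat.cast_prod, Real.log_prod fun p hpA => Nat.cast_ne_zero.mpr (hA p hpA).ne_zero]
  have hcard : (((∏ p ∈ B, p) * e).divisors.card : ℝ) ≤ 2 ^ B.card * (e.divisors.card : ℝ) := by
    exact_mod_cast (card_divisors_mul_le _ _).trans
      (Nat.mul_le_mul_right _ (card_divisors_prod_le hB))
  have hnn : 0 ≤ ∑ p ∈ A, Real.log (p : ℝ) :=
    Finset.sum_nonneg fun p _ => Real.log_natCast_nonneg p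
  rw [hlog]
  calc _ ≤ C * (2 ^ B.card * (e.divisors.card : ℝ)) * (1 + ∑ p ∈ A, Real.log p) := by gcongr
    _ = _ := by ring

open Classical in
/-- The primes up to `n` in the block `j`, without the block leader. -/
noncomputable def blockPrimes (n j : ℕ) : Finset ℕ :=
  (Ioc 0 n).filter fun p => p.Prime ∧ ¬ IsBlockLeader p ∧ primeBlock p = j

lemma mem_blockPrimes {n j p : ℕ} : p ∈ blockPrimes n j ↔
    p ∈ Ioc 0 n ∧ p.Prime ∧ ¬ IsBlockLeader p ∧ primeBlock p = j := by
  classical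
  exact Finset.mem_filter

lemma pairwise_disjoint_blockPrimes (n : ℕ) :
    Pairwise (Function.onFun Disjoint (blockPrimes n)) := by
  intro i j hij
  refine Finset.disjoint_left.mpr fun p hi hj => hij ?_
  rw [← (mem_blockPrimes.mp hi).2.2.2, (mem_blockPrimes.mp hj).2.2.2]

lemma exists_sum_powerset_primeCloseness_le : ∃ C > 0, ∀ n J e : ℕ, 0 < e →
    ∑ S ∈ ((range J).biUnion (blockPrimes n)).powerset,
      primeCloseness n ((∏ p ∈ S, p) * e) / (((∏ p ∈ S, p) * e : ℕ) : ℝ) ≤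
        (e.divisors.card : ℝ) / e *
          (C * (2 * Real.log 2 * Real.exp 1) ^ J * ballotDecay J) := by
  obtain ⟨C₁, hC₁, h₁⟩ := exists_primeCloseness_le
  obtain ⟨C₂, hC₂, h₂⟩ := exists_sum_powerset_mul_prod_le (ι := ℕ)
  obtain ⟨K, hK, h₄⟩ := exists_log_le_mul_two_pow_primeBlock
  refine ⟨C₁ * (C₂ * (1 + K)), by positivity, fun n J e he => ?_⟩
  have hτ : (0 : ℝ) < e.divisors.card := by
    exact_mod_cast Finset.card_pos.mpr ⟨1, Nat.one_mem_divisors.mpr he.ne'⟩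
  have he0 : (0 : ℝ) < e := by exact_mod_cast he
  have h := h₂ (pairwise_disjoint_blockPrimes n) (w := fun p => 1 / (p : ℝ))
    (ℓ := fun p => Real.log (p : ℝ)) (fun p => by positivity) (fun j => sum_primeBlock_le n j)
    (fun p => Real.log_natCast_nonneg p) hK
    (fun j p hp => by
      obtain ⟨-, hpp, -, rfl⟩ := mem_blockPrimes.mp hp
      exact h₄ p hpp) J
    (fun S => primeCloseness n ((∏ p ∈ S, p) * e) / (C₁ * e.divisors.card)) ?_
  · calc _ = ∑ S ∈ ((range J).biUnion (blockPrimes n)).powerset, (e.divisors.card : ℝ) / e * C₁ *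
          (primeCloseness n ((∏ p ∈ S, p) * e) / (C₁ * e.divisors.card) *
            ∏ p ∈ S, 1 / (p : ℝ)) := by
          refine Finset.sum_congr rfl fun S _ => ?_
          rw [Finset.prod_div_distrib, Finset.prod_const_one]
          push_cast
          generalize primeCloseness n _ = x
          generalize ∏ p ∈ S, (p : ℝ) = y
          rcases eq_or_ne y 0 with rfl | hy
          · simp
          · field_simp
      _ ≤ (e.divisors.card : ℝ) / e * C₁ *
            (C₂ * (1 + K) * (2 * Real.log 2 * Real.exp 1) ^ J * ballotDecay J) := by
          rw [← Finset.mul_sum]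
          exact mul_le_mul_of_nonneg_left h (by positivity)
      _ = _ := by ring
  · intro j _ A hA B hB
    have hAm : ∀ p ∈ A, p.Prime ∧ primeBlock p < j := by
      intro p hp
      obtain ⟨i, hi, hpi⟩ := Finset.mem_biUnion.mp (hA hp)
      have := mem_blockPrimes.mp hpi
      exact ⟨this.2.1, by rw [this.2.2.2]; exact Finset.mem_range.mp hi⟩
    have hBm : ∀ p ∈ B, p.Prime ∧ j ≤ primeBlock p := by
      intro p hp
      obtain ⟨i, hi, hpi⟩ := Finset.mem_biUnion.mp (hB hp)
      have := mem_blockPrimes.mp hpi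
      exact ⟨this.2.1, by omega⟩
    have hAB : Disjoint A B := Finset.disjoint_left.mpr fun p hpA hpB => by
      have := (hAm p hpA).2
      have := (hBm p hpB).2
      omega
    have hp : ∀ p ∈ A ∪ B, p.Prime := fun p hp =>
      (Finset.mem_union.mp hp).elim (fun h => (hAm p h).1) fun h => (hBm p h).1
    rw [div_le_iff₀ (by positivity)]
    exact (h₁ n hAB hp he).trans_eq (mul_comm _ _)

lemma exists_sum_primeCloseness_div_le_of_primeBlock_lt : ∃ C > 0, ∀ n J : ℕ,
    (∀ p ∈ Ioc 0 n, p.Prime → primeBlock p < J) →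
    ∑ a ∈ Ioc 0 n, primeCloseness n a / a ≤
      C * (2 * Real.log 2 * Real.exp 1) ^ J * ballotDecay J := by
  classical
  obtain ⟨C₁, hC₁, h₁⟩ := exists_sum_powerset_primeCloseness_le
  obtain ⟨C₂, hC₂, h₂⟩ := exists_sum_card_divisors_div_le
  refine ⟨C₂ * C₁, by positivity, fun n J hJ => ?_⟩
  have hlog := Real.log_pos one_lt_two
  have hb := ballotDecay_pos J
  set E := (Ioc 0 n).filter IsBlockLeader with hE
  calc _ ≤ ∑ T ∈ E.powerset, ∑ m ∈ Ioc 0 n, ∑ S ∈ ((range J).biUnion (blockPrimes n)).powerset,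
        primeCloseness n ((∏ p ∈ S, p) * ((∏ p ∈ T, p) * m ^ 2)) /
          (((∏ p ∈ S, p) * ((∏ p ∈ T, p) * m ^ 2) : ℕ) : ℝ) := by
        refine sum_Ioc_le_sum_powerset_sum_powerset (f := fun a => primeCloseness n a / (a : ℝ))
          (fun p hp hpp => ?_) fun a => div_nonneg (primeCloseness_nonneg _ _) (Nat.cast_nonneg a)
        by_cases hl : IsBlockLeader p
        · exact Or.inr (Finset.mem_filter.mpr ⟨hp, hl⟩)
        · exact Or.inl (Finset.mem_biUnion.mpr ⟨primeBlock p, Finset.mem_range.mpr (hJ p hp hpp),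
            mem_blockPrimes.mpr ⟨hp, hpp, hl, rfl⟩⟩)
    _ ≤ ∑ T ∈ E.powerset, ∑ m ∈ Ioc 0 n, ((((∏ p ∈ T, p) * m ^ 2).divisors.card : ℝ) /
          (((∏ p ∈ T, p) * m ^ 2 : ℕ) : ℝ) *
            (C₁ * (2 * Real.log 2 * Real.exp 1) ^ J * ballotDecay J)) := by
        refine Finset.sum_le_sum fun T hT => Finset.sum_le_sum fun m hm => h₁ n J _ ?_
        refine Nat.mul_pos (Finset.prod_pos fun p hp => ?_)
          (Nat.pow_pos (Finset.mem_Ioc.mp hm).1)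
        exact (Finset.mem_filter.mp (Finset.mem_powerset.mp hT hp)).2.1.pos
    _ ≤ C₂ * (C₁ * (2 * Real.log 2 * Real.exp 1) ^ J * ballotDecay J) := by
        simp_rw [← Finset.sum_mul]
        exact mul_le_mul_of_nonneg_right (h₂ n) (by positivity)
    _ = _ := by ring

lemma exists_primeBlock_lt : ∃ c : ℕ, ∀ i p : ℕ, Real.log p ≤ 2 ^ (i + 1) → p.Prime →
    primeBlock p < i + c := by
  obtain ⟨C, hC, h⟩ := exists_abs_sum_prime_inv_sub_log_log_le
  have hlog := Real.log_pos one_lt_two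
  refine ⟨1 + ⌈C / Real.log 2⌉₊, fun i p hi hp => ?_⟩
  have h1 := (abs_le.mp (h p hp.two_le)).2
  have h2 := primeBlock_lt hp
  rw [primeInvSum] at h2
  have hl : 0 < Real.log p := Real.log_pos (by exact_mod_cast hp.one_lt)
  have h3 : Real.log (Real.log p) ≤ (i + 1) * Real.log 2 := by
    have := Real.log_le_log hl hi
    rw [Real.log_pow] at this
    exact_mod_cast this
  have h4 : C ≤ Real.log 2 * ⌈C / Real.log 2⌉₊ := by
    rw [mul_comm, ← div_le_iff₀ hlog]
    exact Nat.le_ceil _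
  have h5 : (primeBlock p : ℝ) < i + (1 + ⌈C / Real.log 2⌉₊) := by
    refine lt_of_mul_lt_mul_left ?_ hlog.le
    linarith
  exact_mod_cast h5

lemma exists_sum_primeCloseness_div_le : ∃ C > 0, ∀ i n : ℕ, Real.log n ≤ 2 ^ (i + 1) →
    ∑ a ∈ Ioc 0 n, primeCloseness n a / a ≤
      C * (2 * Real.log 2 * Real.exp 1) ^ i * ballotDecay i := by
  obtain ⟨C, hC, h⟩ := exists_sum_primeCloseness_div_le_of_primeBlock_lt
  obtain ⟨c, hc⟩ := exists_primeBlock_lt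
  have hlog := Real.log_pos one_lt_two
  refine ⟨C * (2 * Real.log 2 * Real.exp 1) ^ c, by positivity, fun i n hn => ?_⟩
  refine (h n (i + c) fun p hp hpp => hc i p (le_trans ?_ hn) hpp).trans ?_
  · refine Real.log_le_log (by exact_mod_cast hpp.pos) ?_
    exact_mod_cast (Finset.mem_Ioc.mp hp).2
  · rw [pow_add]
    calc _ ≤ C * ((2 * Real.log 2 * Real.exp 1) ^ i * (2 * Real.log 2 * Real.exp 1) ^ c) *
          ballotDecay i :=
          mul_le_mul_of_nonneg_left (ballotDecay_antitone (by omega)) (by positivity)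
      _ = _ := by ring

lemma one_lt_exp_one_mul_log_two : 1 < Real.exp 1 * Real.log 2 := by
  nlinarith [Real.log_two_gt_d9, Real.exp_one_gt_d9]

lemma exists_one_le_pow_mul_ballotDecay : ∃ C > 0, ∀ i : ℕ,
    1 ≤ C * (Real.exp 1 * Real.log 2) ^ i * ballotDecay i := by
  have ht := tendsto_pow_const_div_const_pow_of_one_lt 2 one_lt_exp_one_mul_log_two
  obtain ⟨C, hC⟩ := ht.bddAbove_range
  have h0 := one_lt_exp_one_mul_log_two
  have hC' : ∀ n : ℕ, (n : ℝ) ^ 2 ≤ C * (Real.exp 1 * Real.log 2) ^ n := fun n => by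
    rw [← div_le_iff₀ (by positivity)]
    exact hC ⟨n, rfl⟩
  have hCp : 0 < C := by
    have := hC' 1
    norm_num at this
    by_contra! hneg
    nlinarith
  refine ⟨C * (Real.exp 1 * Real.log 2), by positivity, fun i => ?_⟩
  have h := hC' (i + 1)
  push_cast at h
  rw [ballotDecay, mul_one_div, one_le_div (by positivity)]
  have hs : √((i : ℝ) + 1) ≤ (i : ℝ) + 1 := by
    rw [Real.sqrt_le_left (by positivity)]
    have : (0 : ℝ) ≤ i := Nat.cast_nonneg i
    nlinarith
  calc ((i : ℝ) + 1) * √((i : ℝ) + 1) ≤ (i + 1) * (i + 1) := by gcongr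
    _ ≤ _ := by rw [← sq]; refine h.trans_eq ?_; ring

lemma sum_log_mul_divisorCloseness_div_le (n : ℕ) :
    ∑ d ∈ Ioc 0 n, Real.log d * (divisorCloseness d / d) ≤
      ∑ a ∈ Ioc 0 n, (∑ q ∈ Ioc 0 n,
        ArithmeticFunction.vonMangoldt q / q * divisorCloseness (a * q)) / a := by
  calc _ = ∑ d ∈ Ioc 0 n, ∑ x ∈ d.divisorsAntidiagonal,
        ArithmeticFunction.vonMangoldt x.2 / x.2 * divisorCloseness (x.1 * x.2) / x.1 := by
        refine Finset.sum_congr rfl fun d hd => ?_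
        rw [← ArithmeticFunction.vonMangoldt_sum, ← Nat.sum_divisorsAntidiagonal'
          (f := fun _ q => ArithmeticFunction.vonMangoldt q), Finset.sum_mul]
        refine Finset.sum_congr rfl fun x hx => ?_
        rw [← (Nat.mem_divisorsAntidiagonal.mp hx).1]
        push_cast
        rw [mul_div_assoc', div_mul_eq_mul_div, div_div, mul_comm (x.1 : ℝ)]
    _ ≤ ∑ x ∈ Ioc 0 n ×ˢ Ioc 0 n,
        ArithmeticFunction.vonMangoldt x.2 / x.2 * divisorCloseness (x.1 * x.2) / x.1 := by
        refine sum_sum_divisorsAntidiagonal_le n fun x => ?_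
        have := divisorCloseness_nonneg (x.1 * x.2)
        have := ArithmeticFunction.vonMangoldt_nonneg (n := x.2)
        positivity
    _ = _ := by
        rw [Finset.sum_product]
        exact Finset.sum_congr rfl fun a _ => by rw [Finset.sum_div]

lemma exists_sum_vonMangoldt_mul_divisorCloseness_le : ∃ C ≥ 0, ∀ n a : ℕ,
    ∑ q ∈ Ioc 0 n, ArithmeticFunction.vonMangoldt q / q * divisorCloseness (a * q) ≤
      primeCloseness n a + C := by
  obtain ⟨C, hC, h⟩ := exists_sum_vonMangoldt_div_not_prime_le
  refine ⟨C, hC, fun n a => ?_⟩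
  rw [← Finset.sum_filter_add_sum_filter_not _ Nat.Prime]
  refine add_le_add (le_of_eq ?_) (le_trans (Finset.sum_le_sum fun q _ => ?_) (h n))
  · refine Finset.sum_congr rfl fun p hp => ?_
    rw [ArithmeticFunction.vonMangoldt_apply_prime (Finset.mem_filter.mp hp).2]
  · exact mul_le_of_le_one_right
      (div_nonneg ArithmeticFunction.vonMangoldt_nonneg (Nat.cast_nonneg q))
      (divisorCloseness_le_one _)

lemma exists_sum_divisorCloseness_div_le : ∃ C > 0, ∀ i n : ℕ, Real.log n ≤ 2 ^ (i + 1) →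
    ∑ d ∈ Ioc 0 n with (2 : ℝ) ^ i ≤ Real.log (d : ℕ), divisorCloseness d / d ≤
      C * (Real.exp 1 * Real.log 2) ^ i * ballotDecay i := by
  obtain ⟨C₁, hC₁, h₁⟩ := exists_sum_primeCloseness_div_le
  obtain ⟨C₂, hC₂, h₂⟩ := exists_sum_vonMangoldt_mul_divisorCloseness_le
  obtain ⟨C₃, hC₃, h₃⟩ := exists_one_le_pow_mul_ballotDecay
  refine ⟨C₁ + 3 * C₂ * C₃, by positivity, fun i n hn => ?_⟩
  have hρ : ∀ d : ℕ, 0 ≤ divisorCloseness d / d := fun d =>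
    div_nonneg (divisorCloseness_nonneg d) (Nat.cast_nonneg d)
  have hharm : ∑ a ∈ Ioc 0 n, 1 / (a : ℝ) ≤ 3 * 2 ^ i := by
    have h := harmonic_le_one_add_log n
    rw [harmonic_eq_sum_Icc] at h
    push_cast at h
    have h1 : (1 : ℝ) ≤ 2 ^ i := one_le_pow₀ one_le_two
    rw [pow_succ] at hn
    simp only [one_div]
    exact h.trans (by linarith)
  refine le_of_mul_le_mul_left ?_ (pow_pos two_pos i : (0 : ℝ) < 2 ^ i)
  calc _ ≤ ∑ d ∈ Ioc 0 n with (2 : ℝ) ^ i ≤ Real.log (d : ℕ),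
        Real.log d * (divisorCloseness d / d) := by
        rw [Finset.mul_sum]
        exact Finset.sum_le_sum fun d hd =>
          mul_le_mul_of_nonneg_right (Finset.mem_filter.mp hd).2 (hρ d)
    _ ≤ ∑ d ∈ Ioc 0 n, Real.log d * (divisorCloseness d / d) :=
        Finset.sum_le_sum_of_subset_of_nonneg (Finset.filter_subset _ _) fun d _ _ =>
          mul_nonneg (Real.log_natCast_nonneg d) (hρ d)
    _ ≤ ∑ a ∈ Ioc 0 n, (primeCloseness n a + C₂) / a :=
        (sum_log_mul_divisorCloseness_div_le n).trans <| Finset.sum_le_sum fun a _ =>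
          div_le_div_of_nonneg_right (h₂ n a) (Nat.cast_nonneg a)
    _ = ∑ a ∈ Ioc 0 n, primeCloseness n a / a + C₂ * ∑ a ∈ Ioc 0 n, 1 / (a : ℝ) := by
        rw [Finset.mul_sum, ← Finset.sum_add_distrib]
        exact Finset.sum_congr rfl fun a _ => by rw [add_div, mul_one_div]
    _ ≤ C₁ * (2 * Real.log 2 * Real.exp 1) ^ i * ballotDecay i + C₂ * (3 * 2 ^ i) :=
        add_le_add (h₁ i n hn) (mul_le_mul_of_nonneg_left hharm hC₂)
    _ ≤ C₁ * (2 * Real.log 2 * Real.exp 1) ^ i * ballotDecay i + C₂ * (3 * 2 ^ i) *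
          (C₃ * (Real.exp 1 * Real.log 2) ^ i * ballotDecay i) :=
        add_le_add_right (le_mul_of_one_le_right (by positivity) (h₃ i)) _
    _ = _ := by
        rw [show 2 * Real.log 2 * Real.exp 1 = 2 * (Real.exp 1 * Real.log 2) by ring, mul_pow]
        ring

/-- The index `i` of the block `2 ^ i ≤ log d < 2 ^ (i + 1)` containing `d`. -/
noncomputable def logBlock (d : ℕ) : ℕ := Nat.log 2 ⌊Real.log d⌋₊

lemma one_le_log_natCast {d : ℕ} (hd : 3 ≤ d) : 1 ≤ Real.log d := by
  have h3 : (3 : ℝ) ≤ d := by exact_mod_cast hd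
  rw [Real.le_log_iff_exp_le (by linarith)]
  linarith [Real.exp_one_lt_d9]

lemma two_pow_logBlock_le {d : ℕ} (hd : 3 ≤ d) : (2 : ℝ) ^ logBlock d ≤ Real.log d := by
  have h0 := one_le_log_natCast hd
  have h1 : ⌊Real.log d⌋₊ ≠ 0 := (Nat.floor_pos.mpr h0).ne'
  calc (2 : ℝ) ^ logBlock d ≤ (⌊Real.log d⌋₊ : ℝ) := by
        exact_mod_cast Nat.pow_log_le_self 2 h1
    _ ≤ _ := Nat.floor_le (by linarith)

lemma log_le_two_pow_logBlock_succ (d : ℕ) : Real.log d ≤ 2 ^ (logBlock d + 1) := by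
  have h := Nat.lt_pow_succ_log_self one_lt_two ⌊Real.log d⌋₊
  calc Real.log d ≤ (⌊Real.log d⌋₊ : ℝ) + 1 := (Nat.lt_floor_add_one _).le
    _ ≤ _ := by exact_mod_cast h

lemma summable_mul_divisorCloseness_div {κ : ℕ → ℝ} (hκ : ∀ i, 0 ≤ κ i)
    (h : Summable fun i => κ i * ((Real.exp 1 * Real.log 2) ^ i * ballotDecay i)) :
    Summable fun d : ℕ => if 3 ≤ d then κ (logBlock d) * (divisorCloseness d / d) else 0 := by
  obtain ⟨C, hC, hle⟩ := exists_sum_divisorCloseness_div_le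
  have hlog := Real.log_pos one_lt_two
  have hρ : ∀ d : ℕ, 0 ≤ divisorCloseness d / d := fun d =>
    div_nonneg (divisorCloseness_nonneg d) (Nat.cast_nonneg d)
  refine summable_of_sum_le (c := C * ∑' i, κ i * ((Real.exp 1 * Real.log 2) ^ i * ballotDecay i))
    (fun d => ?_) fun u => ?_
  · have := mul_nonneg (hκ (logBlock d)) (hρ d)
    dsimp only
    split_ifs
    exacts [this, le_rfl]
  rw [← Finset.sum_filter, ← Finset.sum_fiberwise_of_maps_to (g := logBlock)
    (t := (u.filter (3 ≤ ·)).image logBlock) fun d hd => Finset.mem_image_of_mem _ hd]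
  calc _ ≤ ∑ i ∈ (u.filter (3 ≤ ·)).image logBlock,
        C * (κ i * ((Real.exp 1 * Real.log 2) ^ i * ballotDecay i)) := by
        refine Finset.sum_le_sum fun i _ => ?_
        have hn : Real.log (⌊Real.exp (2 ^ (i + 1))⌋₊ : ℕ) ≤ 2 ^ (i + 1) := by
          rw [Real.log_le_iff_le_exp]
          · exact Nat.floor_le (Real.exp_pos _).le
          · exact_mod_cast Nat.floor_pos.mpr (Real.one_le_exp (by positivity))
        have h1 := hle i _ hn
        calc _ = κ i * ∑ d ∈ (u.filter (3 ≤ ·)).filter (logBlock · = i),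
              divisorCloseness d / d := by
              rw [Finset.mul_sum]
              exact Finset.sum_congr rfl fun d hd => by rw [(Finset.mem_filter.mp hd).2]
          _ ≤ κ i * (C * (Real.exp 1 * Real.log 2) ^ i * ballotDecay i) := by
              refine mul_le_mul_of_nonneg_left (le_trans ?_ h1) (hκ i)
              refine Finset.sum_le_sum_of_subset_of_nonneg (fun d hd => ?_) fun d _ _ => hρ d
              obtain ⟨hdu, rfl⟩ := Finset.mem_filter.mp hd
              obtain ⟨-, hd3⟩ := Finset.mem_filter.mp hdu
              refine Finset.mem_filter.mpr ⟨Finset.mem_Ioc.mpr ⟨by omega, ?_⟩,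
                two_pow_logBlock_le hd3⟩
              refine Nat.le_floor ?_
              have hd0 : (0 : ℝ) < d := by exact_mod_cast (by omega : 0 < d)
              rw [← Real.log_le_iff_le_exp hd0]
              exact log_le_two_pow_logBlock_succ d
          _ = _ := by ring
    _ ≤ _ := by
        rw [← Finset.mul_sum]
        refine mul_le_mul_of_nonneg_left (h.sum_le_tsum _ fun i _ => ?_) hC.le
        have := hκ i
        have := ballotDecay_pos i
        positivity

lemma summable_one_div_mul_one_add_log_rpow {ε : ℝ} (hε : 0 < ε) :
    Summable fun n : ℕ => 1 / ((n : ℝ) * (1 + Real.log n) ^ (1 + ε)) := by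
  rw [← summable_condensed_iff_of_nonneg]
  · have hlog := Real.log_pos one_lt_two
    have h1 := (Real.summable_one_div_nat_rpow (p := 1 + ε)).mpr (by linarith)
    refine Summable.of_nonneg_of_le (fun k => ?_) (fun k => ?_)
      ((summable_nat_add_iff 1).mpr h1 |>.mul_left (1 / Real.log 2 ^ (1 + ε)))
    · have := Real.log_natCast_nonneg (2 ^ k)
      positivity
    · push_cast
      rw [Real.log_pow, mul_one_div, div_mul_eq_div_div, div_self (by positivity),
        one_div_mul_one_div, ← Real.mul_rpow hlog.le (by positivity)]
      have : Real.log 2 ≤ 1 := by linarith [Real.log_le_sub_one_of_pos two_pos]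
      refine one_div_le_one_div_of_le (by positivity)
        (Real.rpow_le_rpow (by positivity) ?_ (by linarith))
      linarith
  · intro n
    have := Real.log_natCast_nonneg n
    positivity
  · intro m n hm hmn
    have hm0 : (0 : ℝ) < m := by exact_mod_cast hm
    have := Real.log_natCast_nonneg m
    gcongr

lemma nint_neg (x : ℝ) : nint (-x) = nint x := by
  have h : ∀ y, nint (-y) ≤ nint y := fun y => by
    have := round_le (-y) (-round y)
    rwa [Int.cast_neg, neg_sub_neg, abs_sub_comm _ y] at this
  exact le_antisymm (h x) (by simpa using h (-x))

lemma nint_pos_of_irrational {x : ℝ} (hx : Irrational x) : 0 < nint x :=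
  abs_pos.mpr (sub_ne_zero.mpr (hx.ne_int _))

lemma volume_nint_lt_le {d : ℕ} (hd : 0 < d) (g : ℝ) :
    volume {α : ℝ | α ∈ Set.Icc (0 : ℝ) 1 ∧ nint (d * α) < g} ≤ ENNReal.ofReal (4 * g) := by
  have hd0 : (0 : ℝ) < d := by exact_mod_cast hd
  have hd1 : (1 : ℝ) ≤ d := by exact_mod_cast hd
  calc _ ≤ volume (⋃ a ∈ range (d + 1), Metric.ball ((a : ℝ) / d) (g / d)) := by
        refine measure_mono fun α hα => ?_
        obtain ⟨⟨h0, h1⟩, h⟩ := hα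
        have hr := abs_sub_round ((d : ℝ) * α)
        obtain ⟨hr1, hr2⟩ := abs_le.mp hr
        have hu : (d : ℝ) * α ≤ d := mul_le_of_le_one_right hd0.le h1
        have hl : 0 ≤ (d : ℝ) * α := by positivity
        have ha0 : 0 ≤ round ((d : ℝ) * α) := by
          have : (-1 : ℝ) < round ((d : ℝ) * α) := by linarith
          have : (-1 : ℤ) < round ((d : ℝ) * α) := by exact_mod_cast this
          omega
        have ha1 : round ((d : ℝ) * α) ≤ d := by
          have : (round ((d : ℝ) * α) : ℝ) < d + 1 := by linarith
          have : round ((d : ℝ) * α) < (d : ℤ) + 1 := by exact_mod_cast this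
          omega
        obtain ⟨a, ha⟩ := Int.eq_ofNat_of_zero_le ha0
        simp only [Set.mem_iUnion, exists_prop]
        refine ⟨a, Finset.mem_range.mpr (by omega), ?_⟩
        rw [nint, ha] at h
        rw [Metric.mem_ball, Real.dist_eq, lt_div_iff₀ hd0]
        calc |α - a / d| * d = |(α - a / d) * d| := by rw [abs_mul, abs_of_pos hd0]
          _ = |d * α - ((a : ℤ) : ℝ)| := by
              congr 1
              push_cast
              field_simp
          _ < g := h
    _ ≤ ∑ a ∈ range (d + 1), volume (Metric.ball ((a : ℝ) / d) (g / d)) :=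
        measure_biUnion_finset_le _ _
    _ = ENNReal.ofReal ((d + 1) * (2 * (g / d))) := by
        simp only [Real.volume_ball, Finset.sum_const, Finset.card_range, nsmul_eq_mul]
        rw [ENNReal.ofReal_mul (p := (d : ℝ) + 1) (by positivity)]
        congr 1
        exact_mod_cast (ENNReal.ofReal_natCast (d + 1)).symm
    _ ≤ _ := by
        rcases le_total 0 g with hg | hg
        · refine ENNReal.ofReal_le_ofReal ?_
          rw [mul_div_assoc', mul_div_assoc', div_le_iff₀ hd0]
          nlinarith
        · rw [ENNReal.ofReal_of_nonpos]
          · exact zero_le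
          · exact mul_nonpos_of_nonneg_of_nonpos (by positivity)
              (mul_nonpos_of_nonneg_of_nonpos two_pos.le (div_nonpos_of_nonpos_of_nonneg hg hd0.le))

lemma ae_eventually_le_nint {g : ℕ → ℝ} (hs : Summable g) :
    ∀ᵐ α ∂(volume : Measure ℝ), α ∈ Set.Icc (0 : ℝ) 1 →
      ∀ᶠ d : ℕ in atTop, g d ≤ nint (d * α) := by
  have h : ∑' d : ℕ, volume {α : ℝ | 0 < d ∧ α ∈ Set.Icc (0 : ℝ) 1 ∧ nint (d * α) < g d} ≠ ⊤ := by
    refine ne_top_of_le_ne_top (hs.mul_left 4).tsum_ofReal_ne_top (ENNReal.tsum_le_tsum fun d => ?_)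
    rcases Nat.eq_zero_or_pos d with rfl | hd
    · simp
    · exact (measure_mono fun α hα => hα.2).trans (volume_nint_lt_le hd (g d))
  filter_upwards [ae_eventually_notMem h] with α hα hα01
  filter_upwards [hα, eventually_gt_atTop 0] with d hd hd0
  by_contra! hlt
  exact hd ⟨hd0, hα01, hlt⟩

/-- The comparison function `(log N) ^ (c - 1) * √(log₂ N) / (N ^ 2 * (log₃ N) ^ (1 + ε))`. -/
noncomputable def squareGap (ε : ℝ) (N : ℕ) : ℝ :=
  (L N) ^ (1 - (1 + Real.log (Real.log 2)) / Real.log 2 - 1) *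
    (LL N) ^ ((1 : ℝ) / 2) / ((N : ℝ) ^ 2 * (LLL N) ^ (1 + ε))

lemma one_le_L (x : ℝ) : 1 ≤ L x := le_max_left _ _

lemma L_mono {x y : ℝ} (hx : 0 < x) (hxy : x ≤ y) : L x ≤ L y :=
  max_le_max le_rfl (Real.log_le_log hx hxy)

lemma L_mul_le {x y : ℝ} (hx : 0 < x) (hxy : x ≤ y) : L y * x ≤ L x * y := by
  have hy : 0 < y := hx.trans_le hxy
  have h1 : Real.log y ≤ Real.log x + (y / x - 1) := by
    have := Real.log_le_sub_one_of_pos (div_pos hy hx)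
    rw [Real.log_div hy.ne' hx.ne'] at this
    linarith
  have h2 : 1 ≤ y / x := (one_le_div hx).mpr hxy
  have h3 : L y ≤ L x * (y / x) := by
    have h4 := one_le_L x
    have h5 : Real.log x ≤ L x := le_max_right _ _
    refine max_le ?_ ?_ <;> nlinarith
  rwa [mul_div_assoc', le_div_iff₀ hx] at h3

lemma half_le_exponent : 1 / 2 ≤ (1 + Real.log (Real.log 2)) / Real.log 2 := by
  have hlog := Real.log_pos one_lt_two
  have h1 : Real.log 2 ≤ Real.log ((Real.exp 1 * Real.log 2) ^ 2) := by
    refine Real.log_le_log two_pos ?_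
    have : 1.5 ≤ Real.exp 1 * Real.log 2 := by
      nlinarith [Real.log_two_gt_d9, Real.exp_one_gt_d9]
    nlinarith
  rw [Real.log_pow, Real.log_mul (Real.exp_pos 1).ne' hlog.ne', Real.log_exp] at h1
  rw [le_div_iff₀ hlog]
  push_cast at h1
  linarith

lemma rpow_mul_sqrt_L_antitone {β x y : ℝ} (hβ : 1 / 2 ≤ β) (hx : 0 < x) (hxy : x ≤ y) :
    y ^ (-β) * L y ^ ((1 : ℝ) / 2) ≤ x ^ (-β) * L x ^ ((1 : ℝ) / 2) := by
  have hy : 0 < y := hx.trans_le hxy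
  have hLx := one_le_L x
  have hLy := one_le_L y
  have key : ∀ z : ℝ, 0 < z → z ^ (-β) * L z ^ ((1 : ℝ) / 2) =
      z ^ (-(β - 1 / 2)) * (L z / z) ^ ((1 : ℝ) / 2) := fun z hz => by
    have hLz := one_le_L z
    rw [Real.div_rpow (by linarith) hz.le, show -β = -(β - 1 / 2) - 1 / 2 by ring,
      Real.rpow_sub hz]
    ring
  rw [key x hx, key y hy]
  refine mul_le_mul ?_ ?_ (by positivity) (by positivity)
  · exact Real.rpow_le_rpow_of_nonpos hx hxy (by linarith)
  · refine Real.rpow_le_rpow (by positivity) ?_ (by norm_num)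
    rw [div_le_div_iff₀ hy hx]
    exact L_mul_le hx hxy

lemma squareGap_anti {ε : ℝ} (hε : 0 < ε) {m N : ℕ} (hm : 0 < m) (h : m ≤ N) :
    squareGap ε N ≤ squareGap ε m := by
  have hm0 : (0 : ℝ) < m := by exact_mod_cast hm
  have hmN : (m : ℝ) ≤ N := by exact_mod_cast h
  have h1 : L m ≤ L N := L_mono hm0 hmN
  have hL := one_le_L m
  have h2 : LL m ≤ LL N := L_mono (by linarith) h1
  have hLL : 1 ≤ LL m := one_le_L _
  have h3 : LLL m ≤ LLL N := L_mono (by linarith) h2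
  have hLLL : 1 ≤ LLL m := one_le_L _
  have h4 := rpow_mul_sqrt_L_antitone half_le_exponent (by linarith : 0 < L m) h1
  have e : 1 - (1 + Real.log (Real.log 2)) / Real.log 2 - 1 =
    -((1 + Real.log (Real.log 2)) / Real.log 2) := by ring
  rw [squareGap, squareGap, e]
  have h5 : 0 ≤ LL (m : ℝ) := by linarith
  refine div_le_div₀ (by positivity) h4 (by positivity) ?_
  gcongr

lemma squareGap_le_one_div_sq {ε : ℝ} (hε : 0 < ε) (N : ℕ) :
    squareGap ε N ≤ 1 / (N : ℝ) ^ 2 := by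
  rcases Nat.eq_zero_or_pos N with rfl | hN
  · simp [squareGap]
  have hL := one_le_L N
  have hN0 : (0 : ℝ) < N := by exact_mod_cast hN
  have h4 := rpow_mul_sqrt_L_antitone half_le_exponent one_pos hL
  have hL1 : L 1 = 1 := by simp [L]
  rw [hL1, Real.one_rpow, Real.one_rpow, one_mul] at h4
  have e : 1 - (1 + Real.log (Real.log 2)) / Real.log 2 - 1 =
    -((1 + Real.log (Real.log 2)) / Real.log 2) := by ring
  have hLLL : 1 ≤ LLL N := one_le_L _
  rw [squareGap, e]
  refine div_le_div₀ zero_le_one h4 (by positivity) ?_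
  exact le_mul_of_one_le_right (by positivity) (Real.one_le_rpow hLLL (by linarith))

/-- The weight of the block `i` in the Borel-Cantelli argument. -/
noncomputable def blockWeight (ε : ℝ) (i : ℕ) : ℝ :=
  √((i : ℝ) + 1) / ((Real.exp 1 * Real.log 2) ^ i * (1 + Real.log ((i : ℝ) + 1)) ^ (1 + ε))

lemma blockWeight_nonneg (ε : ℝ) (i : ℕ) : 0 ≤ blockWeight ε i := by
  have hlog := Real.log_pos one_lt_two
  have : 0 ≤ Real.log ((i : ℝ) + 1) := by exact_mod_cast Real.log_natCast_nonneg (i + 1)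
  unfold blockWeight
  positivity

lemma summable_blockWeight_mul {ε : ℝ} (hε : 0 < ε) :
    Summable fun i => blockWeight ε i * ((Real.exp 1 * Real.log 2) ^ i * ballotDecay i) := by
  have hlog := Real.log_pos one_lt_two
  refine ((summable_nat_add_iff 1).mpr (summable_one_div_mul_one_add_log_rpow hε)).congr fun i => ?_
  have : 0 ≤ Real.log ((i : ℝ) + 1) := by exact_mod_cast Real.log_natCast_nonneg (i + 1)
  rw [blockWeight, ballotDecay]
  push_cast
  have : 0 < (1 + Real.log ((i : ℝ) + 1)) ^ (1 + ε) := by positivity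
  field_simp

lemma one_div_sq_le_divisorCloseness {m n d : ℕ} (hn : n < m) (h : d + n ^ 2 = m ^ 2) :
    1 / (m : ℝ) ^ 2 ≤ 4 * (divisorCloseness d / d) := by
  obtain ⟨u, rfl⟩ := Nat.exists_eq_add_of_lt hn
  have hd : (u + 1) * (n + u + 1 + n) = d := by nlinarith
  have hd0 : d ≠ 0 := by rw [← hd]; positivity
  have h1 := exp_le_divisorCloseness hd hd0
  have hu0 : (0 : ℝ) < ((u + 1 : ℕ) : ℝ) := by positivity
  have hv0 : (0 : ℝ) < ((n + u + 1 + n : ℕ) : ℝ) := by positivity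
  have huv : ((u + 1 : ℕ) : ℝ) ≤ ((n + u + 1 + n : ℕ) : ℝ) := by exact_mod_cast (by omega)
  rw [abs_of_nonpos (by linarith [Real.log_le_log hu0 huv]), neg_neg, Real.exp_sub,
    Real.exp_log hu0, Real.exp_log hv0] at h1
  have hv2 : ((n + u + 1 + n : ℕ) : ℝ) ≤ 2 * ((n + u + 1 : ℕ) : ℝ) := by
    exact_mod_cast (by omega)
  calc 1 / ((n + u + 1 : ℕ) : ℝ) ^ 2 ≤ 4 * (1 / ((n + u + 1 + n : ℕ) : ℝ) ^ 2) := by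
        rw [mul_one_div, div_le_div_iff₀ (by positivity) (by positivity)]
        nlinarith
    _ = 4 * (((u + 1 : ℕ) : ℝ) / ((n + u + 1 + n : ℕ) : ℝ) / d) := by
        rw [← hd]
        push_cast
        field_simp
    _ ≤ _ := by gcongr

lemma one_add_log_le_LLL {m i : ℕ} (h : (2 : ℝ) ^ i ≤ 2 * Real.log m) :
    1 + Real.log ((i : ℝ) + 1) ≤ 4 * LLL m := by
  have hlog := Real.log_two_gt_d9
  have hm : 0 < Real.log m := by
    have : (0 : ℝ) < 2 ^ i := by positivity
    linarith
  have h1 : (i - 1) * Real.log 2 ≤ LL m := by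
    have h2 := Real.log_le_log (by positivity) h
    rw [Real.log_pow, Real.log_mul two_pos.ne' hm.ne'] at h2
    have h3 : Real.log (Real.log m) ≤ LL m :=
      (Real.log_le_log hm (le_max_right _ _)).trans (le_max_right _ _)
    linarith
  have hLL : 1 ≤ LL m := one_le_L _
  have h4 : (i : ℝ) + 1 ≤ 5 * LL m := by nlinarith
  have h5 := Real.log_le_log (by positivity) h4
  rw [Real.log_mul (by norm_num) (by positivity)] at h5
  have h6 : Real.log (LL m) ≤ LLL m := le_max_right _ _
  have hLLL : 1 ≤ LLL m := one_le_L _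
  have h7 : Real.log 5 ≤ 2 := by
    rw [Real.log_le_iff_le_exp (by norm_num), show (2 : ℝ) = 1 + 1 by norm_num, Real.exp_add]
    nlinarith [Real.exp_one_gt_d9]
  linarith

lemma two_rpow_exponent :
    (2 : ℝ) ^ ((1 + Real.log (Real.log 2)) / Real.log 2) = Real.exp 1 * Real.log 2 := by
  have hlog := Real.log_pos one_lt_two
  rw [Real.rpow_def_of_pos two_pos, mul_div_cancel₀ _ hlog.ne', Real.exp_add, Real.exp_log hlog]

lemma exists_squareGap_le {ε : ℝ} (hε : 0 < ε) : ∃ C > 0, ∀ {m n d : ℕ}, n < m → 3 ≤ d →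
    d + n ^ 2 = m ^ 2 →
    squareGap ε m ≤ C * (blockWeight ε (logBlock d) * (divisorCloseness d / d)) := by
  have hlog := Real.log_pos one_lt_two
  set X := Real.exp 1 * Real.log 2 with hX
  have hX0 : 0 < X := by positivity
  refine ⟨X * 4 ^ (1 + ε) * 4, by positivity, fun {m n d} hnm hd h => ?_⟩
  set i := logBlock d with hi
  have hm0 : (0 : ℝ) < m := by exact_mod_cast (by omega : 0 < m)
  have hd0 : (0 : ℝ) < d := by exact_mod_cast (by omega : 0 < d)
  have hmd : m ≤ d := by nlinarith
  have hdm : d ≤ m ^ 2 := by omega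
  have hlogd : Real.log d ≤ 2 * Real.log m := by
    have := Real.log_le_log hd0 (by exact_mod_cast hdm : (d : ℝ) ≤ (m : ℝ) ^ 2)
    rwa [Real.log_pow] at this
  have hlogm : Real.log m ≤ 2 ^ (i + 1) :=
    (Real.log_le_log hm0 (by exact_mod_cast hmd)).trans (log_le_two_pow_logBlock_succ d)
  have hi2 : (2 : ℝ) ^ i ≤ 2 * Real.log m := (two_pow_logBlock_le hd).trans hlogd
  have hL : (2 : ℝ) ^ i / 2 ≤ L m := by
    have : Real.log m ≤ L m := le_max_right _ _
    linarith
  have hL1 := one_le_L m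
  have hLβ : (L m) ^ (1 - (1 + Real.log (Real.log 2)) / Real.log 2 - 1) ≤ X / X ^ i := by
    have hβ := half_le_exponent
    rw [show 1 - (1 + Real.log (Real.log 2)) / Real.log 2 - 1 =
      -((1 + Real.log (Real.log 2)) / Real.log 2) by ring]
    refine (Real.rpow_le_rpow_of_nonpos (by positivity) hL (by linarith)).trans_eq ?_
    rw [Real.rpow_neg (by positivity), Real.div_rpow (by positivity) two_pos.le, inv_div,
      ← Real.rpow_natCast, ← Real.rpow_mul two_pos.le, mul_comm (i : ℝ), Real.rpow_mul two_pos.le,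
      two_rpow_exponent, Real.rpow_natCast]
  have hLL : (LL m) ^ ((1 : ℝ) / 2) ≤ √((i : ℝ) + 1) := by
    rw [← Real.sqrt_eq_rpow]
    refine Real.sqrt_le_sqrt (max_le (by simp) ?_)
    have h1 : L m ≤ 2 ^ (i + 1) := max_le (one_le_pow₀ one_le_two) hlogm
    have h2 := Real.log_le_log (by linarith) h1
    rw [Real.log_pow] at h2
    push_cast at h2
    have : Real.log 2 ≤ 1 := by linarith [Real.log_le_sub_one_of_pos two_pos]
    exact h2.trans (mul_le_of_le_one_right (by positivity) this)
  have hLLL1 : 1 ≤ LLL m := one_le_L _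
  have hlogi : 0 ≤ Real.log ((i : ℝ) + 1) := by exact_mod_cast Real.log_natCast_nonneg (i + 1)
  have hLLL : 1 / (LLL m) ^ (1 + ε) ≤ 4 ^ (1 + ε) / (1 + Real.log ((i : ℝ) + 1)) ^ (1 + ε) := by
    rw [div_le_div_iff₀ (by positivity) (by positivity), one_mul,
      ← Real.mul_rpow (by norm_num) (by positivity)]
    exact Real.rpow_le_rpow (by positivity) (one_add_log_le_LLL hi2) (by linarith)
  have hLL0 : 0 ≤ LL (m : ℝ) := zero_le_one.trans (one_le_L _)
  calc squareGap ε m = (L m) ^ (1 - (1 + Real.log (Real.log 2)) / Real.log 2 - 1) *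
        (LL m) ^ ((1 : ℝ) / 2) * (1 / (LLL m) ^ (1 + ε)) * (1 / (m : ℝ) ^ 2) := by
        rw [squareGap]
        field_simp
    _ ≤ X / X ^ i * √((i : ℝ) + 1) *
          (4 ^ (1 + ε) / (1 + Real.log ((i : ℝ) + 1)) ^ (1 + ε)) *
          (4 * (divisorCloseness d / d)) := by
        gcongr
        exact one_div_sq_le_divisorCloseness hnm h
    _ = _ := by
        rw [blockWeight, ← hX]
        field_simp

end

theorem stmt11 (ε : ℝ) (hε : 0 < ε) :
    ∀ᵐ α ∂(volume : Measure ℝ), α ∈ Set.Icc (0 : ℝ) 1 →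
      ∃ N₀ : ℕ, ∀ N ≥ N₀,
        deltaMin (fun n => n ^ 2) α N ≥
          (L N) ^ (1 - (1 + Real.log (Real.log 2)) / Real.log 2 - 1) *
            (LL N) ^ ((1 : ℝ) / 2) / ((N : ℝ) ^ 2 * (LLL N) ^ (1 + ε)) := by
  obtain ⟨C, hC, hle⟩ := exists_squareGap_le hε
  have hs := (summable_mul_divisorCloseness_div (blockWeight_nonneg ε)
    (summable_blockWeight_mul hε)).mul_left C
  have hae := ae_eventually_le_nint hs
  have hirr := (Set.countable_range ((↑) : ℚ → ℝ)).ae_notMem volume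
  filter_upwards [hae, hirr] with α hα hαirr hα01
  obtain ⟨D, hD⟩ := eventually_atTop.mp (hα hα01)
  have hsmall : ∀ᶠ N : ℕ in atTop, ∀ d ∈ Finset.Ioc 0 (max D 3),
      1 / (N : ℝ) ^ 2 ≤ nint (d * α) := by
    rw [eventually_all_finset]
    intro d hd
    have hpos : 0 < nint (d * α) :=
      nint_pos_of_irrational (Irrational.natCast_mul hαirr (Finset.mem_Ioc.mp hd).1.ne')
    have ht : Tendsto (fun N : ℕ => 1 / (N : ℝ) ^ 2) atTop (nhds 0) :=
      (tendsto_const_div_pow (1 : ℝ) 2 two_ne_zero).comp tendsto_natCast_atTop_atTop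
    exact ht.eventually (ge_mem_nhds hpos)
  obtain ⟨N₁, hN₁⟩ := eventually_atTop.mp hsmall
  refine ⟨max N₁ 2, fun N hN => ?_⟩
  change squareGap ε N ≤ deltaMin (fun n => n ^ 2) α N
  have key : ∀ m n : ℕ, m ≤ N → 1 ≤ n → n < m →
      squareGap ε N ≤ nint ((((m ^ 2 : ℕ) : ℝ) - ((n ^ 2 : ℕ) : ℝ)) * α) := by
    intro m n hm hn hnm
    obtain ⟨d, hd⟩ := Nat.exists_eq_add_of_lt (Nat.pow_lt_pow_left hnm two_ne_zero)
    have hd' : (d + 1) + n ^ 2 = m ^ 2 := by omega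
    rw [← hd', Nat.cast_add (d + 1), add_sub_cancel_right]
    rcases le_or_gt (d + 1) (max D 3) with h | h
    · exact (squareGap_le_one_div_sq hε N).trans
        (hN₁ N ((le_max_left _ _).trans hN) _ (Finset.mem_Ioc.mpr ⟨Nat.succ_pos d, h⟩))
    · have h3 : 3 ≤ d + 1 := ((le_max_right _ _).trans_lt h).le
      have h4 := hD (d + 1) ((le_max_left _ _).trans_lt h).le
      rw [if_pos h3] at h4
      exact (squareGap_anti hε (by omega) hm).trans ((hle hnm h3 hd').trans h4)
  refine le_csInf ⟨_, 1, 2, le_rfl, ?_, ?_, ?_, ?_, rfl⟩ ?_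
  · have := (le_max_right N₁ 2).trans hN; omega
  · norm_num
  · exact (le_max_right N₁ 2).trans hN
  · norm_num
  · rintro x ⟨m, n, hm1, hmN, hn1, hnN, hmn, rfl⟩
    rcases lt_or_gt_of_ne hmn with h | h
    · rw [← nint_neg, ← neg_mul, neg_sub]
      exact key n m hnN hm1 h
    · exact key m n hmN hn1 h
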